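/- arXiv:2111.04263 — 3 statements merged into one kernel-verified Lean document; each statement's English description precedes it below -/
import Mathlib

section
/- Under the FedDyn process with each L_k additionally convex and with θ* a global minimizer of ℓ, if α ≥ 25·L then the expected suboptimality of the time-averaged active-device average satisfies E[ ℓ( (1/T) ∑_{t=0}^{T−1} γ^t ) − ℓ(θ*) ] ≤ (1/T) · ( 10·α·‖θ^0 − θ*‖² + (100/α)·(m/P) · (1/m) ∑_{k=1}^m ‖∇L_k(θ*)‖² ). -/
open scoped RealInnerProductSpace

set_option linter.unusedSectionVars false

section FedDynAux
variable {E : Type*} [NormedAddCommGroup E] [InnerProductSpace ℝ E] [CompleteSpace E]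

lemma fd_hasDeriv (f : E → ℝ) (hf : Differentiable ℝ f) (x v : E) :
    HasDerivAt (fun s : ℝ => f (x + s • v)) ⟪gradient f x, v⟫ 0 := by
  have h1 : HasFDerivAt f (fderiv ℝ f x) (x + (0:ℝ) • v) := by
    simpa using (hf x).hasFDerivAt
  have h2 : HasDerivAt (fun s : ℝ => x + s • v) v 0 := by
    simpa using ((hasDerivAt_id (0:ℝ)).smul_const v).const_add x
  have := h1.comp_hasDerivAt (0:ℝ) h2
  rw [inner_gradient_left]
  exact this

lemma fd_grad_ineq (f : E → ℝ) (hf : Differentiable ℝ f) (hc : ConvexOn ℝ Set.univ f) (x y : E) :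
    f x + ⟪gradient f x, y - x⟫ ≤ f y := by
  have hcc : ConvexOn ℝ Set.univ (fun s : ℝ => f (x + s • (y - x))) := by
    refine ⟨convex_univ, fun a _ b _ p q hp hq hpq => ?_⟩
    have := hc.2 (Set.mem_univ (x + a • (y - x))) (Set.mem_univ (x + b • (y - x))) hp hq hpq
    have e : x + (p • a + q • b) • (y - x)
        = p • (x + a • (y - x)) + q • (x + b • (y - x)) := by
      have : x = (p + q) • x := by rw [hpq, one_smul]
      nth_rewrite 1 [this]
      simp only [smul_eq_mul]
      module
    simp only [e]
    exact this
  have := hcc.le_slope_of_hasDerivAt (x := 0) (y := 1) (Set.mem_univ _) (Set.mem_univ _) one_pos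
    (fd_hasDeriv f hf x (y - x))
  rw [inner_gradient_left] at this ⊢
  simp [slope] at this ⊢
  linarith

lemma fd_descent (f : E → ℝ) (hf : Differentiable ℝ f) (hc : ConvexOn ℝ Set.univ f) (L : ℝ)
    (hs : ∀ x y, ‖gradient f x - gradient f y‖ ≤ L * ‖x - y‖) (x y : E) :
    f y ≤ f x + ⟪gradient f x, y - x⟫ + L * ‖y - x‖ ^ 2 := by
  have h1 := fd_grad_ineq f hf hc y x
  have h2 : ⟪gradient f y - gradient f x, y - x⟫ ≤ L * ‖y - x‖ ^ 2 := by
    calc _ ≤ ‖gradient f y - gradient f x‖ * ‖y - x‖ := real_inner_le_norm _ _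
      _ ≤ (L * ‖y - x‖) * ‖y - x‖ := by gcongr; exact hs y x
      _ = _ := by ring
  rw [inner_sub_left] at h2
  have h3 : ⟪gradient f y, x - y⟫ = - ⟪gradient f y, y - x⟫ := by
    rw [← inner_neg_right, neg_sub]
  linarith

lemma fd_coco (f : E → ℝ) (hf : Differentiable ℝ f) (hc : ConvexOn ℝ Set.univ f) (L : ℝ)
    (hL : 0 < L)
    (hs : ∀ x y, ‖gradient f x - gradient f y‖ ≤ L * ‖x - y‖) (x y : E) :
    ‖gradient f x - gradient f y‖ ^ 2 ≤ 4 * L * (f x - f y - ⟪gradient f y, x - y⟫) := by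
  set u := gradient f x - gradient f y with hu
  have h1 := fd_descent f hf hc L hs x (x - (2 * L)⁻¹ • u)
  have h2 := fd_grad_ineq f hf hc y (x - (2 * L)⁻¹ • u)
  have e1 : x - (2 * L)⁻¹ • u - x = - ((2 * L)⁻¹ • u) := by abel
  have e2 : x - (2 * L)⁻¹ • u - y = (x - y) - ((2 * L)⁻¹ • u) := by abel
  rw [e1, inner_neg_right, norm_neg, norm_smul, inner_smul_right, mul_pow, Real.norm_eq_abs,
    sq_abs] at h1
  rw [e2, inner_sub_right, inner_smul_right] at h2
  have h3 : ⟪gradient f x, u⟫ - ⟪gradient f y, u⟫ = ‖u‖ ^ 2 := by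
    rw [← inner_sub_left, real_inner_self_eq_norm_sq]
  have h4 : (2 * L)⁻¹ * ‖u‖ ^ 2 - L * ((2 * L)⁻¹ ^ 2 * ‖u‖ ^ 2)
      ≤ f x - f y - ⟪gradient f y, x - y⟫ := by
    rw [← h3]; rw [← h3] at h1; linarith
  have h5 : (2 * L)⁻¹ * ‖u‖ ^ 2 - L * ((2 * L)⁻¹ ^ 2 * ‖u‖ ^ 2) = ‖u‖ ^ 2 / (4 * L) := by
    field_simp; ring
  rw [h5, div_le_iff₀ (by positivity)] at h4
  linarith

lemma fd_three (a b c : E) : ‖a - b - c‖ ^ 2 ≤ 3 * (‖a‖ ^ 2 + ‖b‖ ^ 2 + ‖c‖ ^ 2) := by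
  have h : ‖a - b - c‖ ≤ ‖a‖ + ‖b‖ + ‖c‖ := by
    linarith [norm_sub_le (a - b) c, norm_sub_le a b]
  have := pow_le_pow_left₀ (norm_nonneg _) h 2
  nlinarith [sq_nonneg (‖a‖ - ‖b‖), sq_nonneg (‖a‖ - ‖c‖), sq_nonneg (‖b‖ - ‖c‖)]

lemma fd_two (a b : E) : ‖a + b‖ ^ 2 ≤ 2 * (‖a‖ ^ 2 + ‖b‖ ^ 2) := by
  have := pow_le_pow_left₀ (norm_nonneg _) (norm_add_le a b) 2
  nlinarith [sq_nonneg (‖a‖ - ‖b‖)]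

lemma fd_avg_sq {ι : Type*} (S : Finset ι) (P : ℕ) (hP : 1 ≤ P) (hS : S.card = P) (v : ι → E) :
    ‖(P : ℝ)⁻¹ • ∑ k ∈ S, v k‖ ^ 2 ≤ (P : ℝ)⁻¹ * ∑ k ∈ S, ‖v k‖ ^ 2 := by
  have hP' : (0:ℝ) < P := by exact_mod_cast hP
  have h1 : ‖∑ k ∈ S, v k‖ ^ 2 ≤ P * ∑ k ∈ S, ‖v k‖ ^ 2 := by
    calc _ ≤ (∑ k ∈ S, ‖v k‖) ^ 2 := pow_le_pow_left₀ (norm_nonneg _) (norm_sum_le _ _) 2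
      _ ≤ S.card * ∑ k ∈ S, ‖v k‖ ^ 2 := sq_sum_le_card_mul_sum_sq
      _ = _ := by rw [hS]
  rw [norm_smul, mul_pow, Real.norm_eq_abs, sq_abs]
  calc _ ≤ (P : ℝ)⁻¹ ^ 2 * (P * ∑ k ∈ S, ‖v k‖ ^ 2) := by gcongr
    _ = _ := by field_simp

lemma fd_variance (m : ℕ) (hm : 1 ≤ m) (a : Fin m → E) :
    ∑ k, ‖a k - (m : ℝ)⁻¹ • ∑ j, a j‖ ^ 2 ≤ ∑ k, ‖a k‖ ^ 2 := by
  have hm' : (0:ℝ) < m := by exact_mod_cast hm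
  set b := (m : ℝ)⁻¹ • ∑ j, a j with hb
  have hs : ∑ j, a j = (m : ℝ) • b := by rw [hb, smul_inv_smul₀ hm'.ne']
  simp only [norm_sub_sq_real, Finset.sum_add_distrib, Finset.sum_sub_distrib]
  rw [← Finset.mul_sum, ← sum_inner, hs, real_inner_smul_left, real_inner_self_eq_norm_sq]
  simp
  nlinarith [mul_nonneg hm'.le (sq_nonneg ‖b‖)]

/-- Counting: every device is in the same number of active sets. -/
lemma fd_count (m P : ℕ) (hm : 1 ≤ m) : ∃ c : ℕ,
    (∀ k : Fin m, (Finset.univ.filter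
      (fun S : {S : Finset (Fin m) // S.card = P} => k ∈ S.1)).card = c) ∧
    m * c = Fintype.card {S : Finset (Fin m) // S.card = P} * P := by
  have key : ∀ k j : Fin m, (Finset.univ.filter
      (fun S : {S : Finset (Fin m) // S.card = P} => k ∈ S.1)).card ≤ (Finset.univ.filter
      (fun S : {S : Finset (Fin m) // S.card = P} => j ∈ S.1)).card := by
    intro k j
    refine Finset.card_le_card_of_injOn
      (fun S => ⟨S.1.map (Equiv.swap k j).toEmbedding, by simpa using S.2⟩) ?_ ?_
    · intro S hS
      simp only [Finset.coe_filter, Finset.mem_univ, true_and, Set.mem_ofPred_eq] at hS ⊢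
      exact Finset.mem_map.2 ⟨k, hS, by simp⟩
    · intro S _ S' _ h
      simp only [Subtype.mk.injEq, Finset.map_inj] at h
      exact Subtype.ext h
  refine ⟨_, fun k => le_antisymm (key k ⟨0, hm⟩) (key ⟨0, hm⟩ k), ?_⟩
  have h1 : ∑ k : Fin m, (Finset.univ.filter
      (fun S : {S : Finset (Fin m) // S.card = P} => k ∈ S.1)).card
      = ∑ S : {S : Finset (Fin m) // S.card = P}, S.1.card := by
    simp only [Finset.card_filter]
    rw [Finset.sum_comm]
    refine Finset.sum_congr rfl fun S _ => ?_
    rw [← Finset.card_filter]; simp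
  rw [Finset.sum_congr (g := fun _ => P) rfl
    (fun (S : {S : Finset (Fin m) // S.card = P}) _ => S.2)] at h1
  rw [Finset.sum_congr rfl (fun k _ => le_antisymm (key k ⟨0, hm⟩) (key ⟨0, hm⟩ k))] at h1
  simpa using h1

lemma fd_sum_active {F : Type*} [AddCommGroup F] [Module ℝ F] (m P : ℕ) (hm : 1 ≤ m)
    (f : Fin m → F) :
    ∑ S : {S : Finset (Fin m) // S.card = P}, ∑ k ∈ S.1, f k
      = ((Fintype.card {S : Finset (Fin m) // S.card = P} : ℝ) * P / m) • ∑ k, f k := by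
  obtain ⟨c, hc, hmc⟩ := fd_count m P hm
  have hm' : (0:ℝ) < m := by exact_mod_cast hm
  have hcr : (Fintype.card {S : Finset (Fin m) // S.card = P} : ℝ) * P / m = c := by
    rw [div_eq_iff hm'.ne']
    have : (m : ℝ) * c = (Fintype.card {S : Finset (Fin m) // S.card = P} : ℝ) * P := by
      exact_mod_cast hmc
    rw [← this]; ring
  rw [hcr, Finset.smul_sum]
  have : ∀ S : {S : Finset (Fin m) // S.card = P}, ∑ k ∈ S.1, f k
      = ∑ k, if k ∈ S.1 then f k else 0 := by
    intro S; simp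
  rw [Finset.sum_congr rfl (fun S _ => this S), Finset.sum_comm]
  refine Finset.sum_congr rfl fun k _ => ?_
  rw [← Finset.sum_filter, Finset.sum_const, hc k, Nat.cast_smul_eq_nsmul]

/-- Resampling one coordinate. -/
lemma fd_resample {ι A : Type*} [Fintype ι] [DecidableEq ι] [Fintype A] (i : ι)
    (F : (ι → A) → ℝ) :
    ∑ ω : ι → A, ∑ a : A, F (Function.update ω i a) = (Fintype.card A : ℝ) * ∑ ω, F ω := by
  classical
  have hinv : Function.Involutive
      (fun p : (ι → A) × A => (Function.update p.1 i p.2, p.1 i)) := by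
    rintro ⟨ω, a⟩
    simp
  rw [← Fintype.sum_prod_type' (f := fun ω a => F (Function.update ω i a))]
  rw [show (∑ p : (ι → A) × A, F (Function.update p.1 i p.2))
    = ∑ p : (ι → A) × A, F p.1 from
      Equiv.sum_comp (hinv.toPerm _) (fun p : (ι → A) × A => F p.1)]
  rw [Fintype.sum_prod_type]
  simp [Finset.mul_sum]


lemma fd_scalar (α L e c w D : ℝ) (hα : 0 < α) (hL : 0 < L) (hαL : 25 * L ≤ α) (he : 0 ≤ e)
    (hD : 0 ≤ D) (hw : w ≤ 2 * (L ^ 2 * e + 4 * L * D))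
    (h4 : α ^ 2 * e ≤ 3 * (c + L ^ 2 * e + 4 * L * D)) :
    2 * (α⁻¹ * (-D + L * e)) + e + 7 / 2 / α ^ 2 * (w - c) ≤ - (D / (10 * α)) := by
  have h1 : 0 ≤ D * (α - 25 * L) := mul_nonneg hD (by linarith)
  have h2 : 0 ≤ e * (α * (α - 25 * L)) := mul_nonneg he (mul_nonneg hα.le (by linarith))
  have h3 : 0 ≤ e * (L * (α - 25 * L)) := mul_nonneg he (mul_nonneg hL.le (by linarith))
  have h5 : 0 ≤ D * α := mul_nonneg hD hα.le
  have h6 : 0 ≤ e * α ^ 2 := mul_nonneg he (by positivity)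
  have key : 2 * (α * (-D + L * e)) + α ^ 2 * e + 7 / 2 * (w - c) + α * D / 10 ≤ 0 := by
    nlinarith
  have e1 : 2 * (α⁻¹ * (-D + L * e)) + e + 7 / 2 / α ^ 2 * (w - c) + D / (10 * α)
      = (2 * (α * (-D + L * e)) + α ^ 2 * e + 7 / 2 * (w - c) + α * D / 10) / α ^ 2 := by
    field_simp
  have := div_nonpos_of_nonpos_of_nonneg key (sq_nonneg α)
  linarith

lemma fd_one_step (m P : ℕ) (hm : 1 ≤ m) (hP : 1 ≤ P)
    (α L : ℝ) (hα : 0 < α) (hL : 0 < L) (hαL : 25 * L ≤ α)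
    (Lk : Fin m → E → ℝ)
    (hdiff : ∀ k, Differentiable ℝ (Lk k))
    (hconv : ∀ k, ConvexOn ℝ Set.univ (Lk k))
    (hsmooth : ∀ k x y, ‖gradient (Lk k) x - gradient (Lk k) y‖ ≤ L * ‖x - y‖)
    (θs γ : E) (hG : ∑ k, gradient (Lk k) θs = 0)
    (hmin : 0 ≤ ∑ k, (Lk k γ - Lk k θs))
    (g z : Fin m → E)
    (hz : ∀ k, gradient (Lk k) (z k) - g k
      + α • (z k - (γ - α⁻¹ • ((m : ℝ)⁻¹ • ∑ j, g j))) = 0) :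
    ∑ S : {S : Finset (Fin m) // S.card = P},
      (‖(P : ℝ)⁻¹ • ∑ k ∈ S.1, z k - θs‖ ^ 2 + 7 / 2 / α ^ 2 / P *
        ∑ k, ‖(if k ∈ S.1 then gradient (Lk k) (z k) else g k) - gradient (Lk k) θs‖ ^ 2)
    ≤ (Fintype.card {S : Finset (Fin m) // S.card = P} : ℝ) *
      (‖γ - θs‖ ^ 2 + 7 / 2 / α ^ 2 / P * ∑ k, ‖g k - gradient (Lk k) θs‖ ^ 2
        - ((m : ℝ)⁻¹ * ∑ k, (Lk k γ - Lk k θs)) / (10 * α)) := by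
  have hm' : (0:ℝ) < m := by exact_mod_cast hm
  have hP' : (0:ℝ) < P := by exact_mod_cast hP
  set N : ℝ := (Fintype.card {S : Finset (Fin m) // S.card = P} : ℝ) with hN
  have hN0 : 0 ≤ N := Nat.cast_nonneg _
  set D := ∑ k, (Lk k γ - Lk k θs) with hD
  set e := ∑ k, ‖z k - γ‖ ^ 2 with he
  set c := ∑ k, ‖g k - gradient (Lk k) θs‖ ^ 2 with hc
  set w := ∑ k, ‖gradient (Lk k) (z k) - gradient (Lk k) θs‖ ^ 2 with hw
  set h := (m : ℝ)⁻¹ • ∑ j, g j with hh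
  have hmh : ∑ j, g j = (m : ℝ) • h := by rw [hh, smul_inv_smul₀ hm'.ne']
  have hz' : ∀ k, α • (z k - γ) = g k - h - gradient (Lk k) (z k) := by
    intro k
    have := hz k
    have e1 : α • (z k - (γ - α⁻¹ • h)) = α • (z k - γ) + h := by
      rw [show z k - (γ - α⁻¹ • h) = (z k - γ) + α⁻¹ • h by abel, smul_add, smul_inv_smul₀ hα.ne']
    rw [e1] at this
    have h2 : α • (z k - γ) = α • (z k - γ) - (gradient (Lk k) (z k) - g k + (α • (z k - γ) + h)) := by
      rw [this, sub_zero]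
    rw [h2]; abel
  have he0 : 0 ≤ e := Finset.sum_nonneg fun k _ => sq_nonneg _
  -- cocoercivity summed
  have hcoco : ∑ k, ‖gradient (Lk k) γ - gradient (Lk k) θs‖ ^ 2 ≤ 4 * L * D := by
    calc _ ≤ ∑ k, 4 * L * (Lk k γ - Lk k θs - ⟪gradient (Lk k) θs, γ - θs⟫) :=
          Finset.sum_le_sum fun k _ => fd_coco (Lk k) (hdiff k) (hconv k) L hL (hsmooth k) γ θs
      _ = 4 * L * D := by
          rw [← Finset.mul_sum, Finset.sum_sub_distrib, ← sum_inner, hG, inner_zero_left, sub_zero]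
  have hbb : ∀ k, ‖gradient (Lk k) (z k) - gradient (Lk k) γ‖ ^ 2 ≤ L ^ 2 * ‖z k - γ‖ ^ 2 := by
    intro k
    have := pow_le_pow_left₀ (norm_nonneg _) (hsmooth k (z k) γ) 2
    rwa [mul_pow] at this
  have hbsum : ∑ k, ‖gradient (Lk k) (z k) - gradient (Lk k) γ‖ ^ 2 ≤ L ^ 2 * e := by
    rw [he, Finset.mul_sum]
    exact Finset.sum_le_sum fun k _ => hbb k
  have hwle : w ≤ 2 * (L ^ 2 * e + 4 * L * D) := by
    calc w ≤ ∑ k, 2 * (‖gradient (Lk k) (z k) - gradient (Lk k) γ‖ ^ 2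
            + ‖gradient (Lk k) γ - gradient (Lk k) θs‖ ^ 2) := by
          refine Finset.sum_le_sum fun k _ => ?_
          have := fd_two (gradient (Lk k) (z k) - gradient (Lk k) γ)
            (gradient (Lk k) γ - gradient (Lk k) θs)
          rwa [sub_add_sub_cancel] at this
      _ = 2 * (∑ k, ‖gradient (Lk k) (z k) - gradient (Lk k) γ‖ ^ 2
            + ∑ k, ‖gradient (Lk k) γ - gradient (Lk k) θs‖ ^ 2) := by
          rw [← Finset.mul_sum, Finset.sum_add_distrib]
      _ ≤ _ := by linarith
  have h4 : α ^ 2 * e ≤ 3 * (c + L ^ 2 * e + 4 * L * D) := by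
    have hbar : (m : ℝ)⁻¹ • ∑ j, (g j - gradient (Lk j) θs) = h := by
      rw [Finset.sum_sub_distrib, hG, sub_zero]
    have hvar := fd_variance m hm (fun k => g k - gradient (Lk k) θs)
    rw [hbar] at hvar
    calc α ^ 2 * e = ∑ k, ‖α • (z k - γ)‖ ^ 2 := by
          rw [he, Finset.mul_sum]
          refine Finset.sum_congr rfl fun k _ => ?_
          rw [norm_smul, mul_pow, Real.norm_eq_abs, sq_abs]
      _ ≤ ∑ k, 3 * (‖g k - gradient (Lk k) θs - h‖ ^ 2
            + ‖gradient (Lk k) (z k) - gradient (Lk k) γ‖ ^ 2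
            + ‖gradient (Lk k) γ - gradient (Lk k) θs‖ ^ 2) := by
          refine Finset.sum_le_sum fun k _ => ?_
          have := fd_three (g k - gradient (Lk k) θs - h)
            (gradient (Lk k) (z k) - gradient (Lk k) γ) (gradient (Lk k) γ - gradient (Lk k) θs)
          rw [hz' k]
          refine le_of_eq_of_le ?_ this
          congr 2
          abel
      _ = 3 * (∑ k, ‖g k - gradient (Lk k) θs - h‖ ^ 2
            + ∑ k, ‖gradient (Lk k) (z k) - gradient (Lk k) γ‖ ^ 2
            + ∑ k, ‖gradient (Lk k) γ - gradient (Lk k) θs‖ ^ 2) := by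
          rw [← Finset.mul_sum, Finset.sum_add_distrib, Finset.sum_add_distrib]
      _ ≤ _ := by linarith
  -- inner product term
  have hinner : ∑ k, ⟪γ - θs, z k - γ⟫ ≤ α⁻¹ * (-D + L * e) := by
    have hv : ∑ k, (z k - γ) = - (α⁻¹ • ∑ k, gradient (Lk k) (z k)) := by
      have : α • ∑ k, (z k - γ) = - ∑ k, gradient (Lk k) (z k) := by
        rw [Finset.smul_sum, Finset.sum_congr rfl (fun k _ => hz' k), Finset.sum_sub_distrib,
          Finset.sum_sub_distrib, hmh]
        simp [← Nat.cast_smul_eq_nsmul ℝ]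
      rw [← smul_neg, ← this, inv_smul_smul₀ hα.ne']
    rw [← inner_sum, hv, inner_neg_right, inner_smul_right, inner_sum]
    have : ∑ k, (Lk k γ - Lk k θs - L * ‖z k - γ‖ ^ 2) ≤ ∑ k, ⟪γ - θs, gradient (Lk k) (z k)⟫ := by
      refine Finset.sum_le_sum fun k _ => ?_
      have h1 := fd_grad_ineq (Lk k) (hdiff k) (hconv k) (z k) θs
      have h2 := fd_descent (Lk k) (hdiff k) (hconv k) L (hsmooth k) (z k) γ
      rw [real_inner_comm, show γ - θs = (γ - z k) - (θs - z k) by abel, inner_sub_right,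
        norm_sub_rev (z k) γ]
      linarith
    rw [Finset.sum_sub_distrib, ← Finset.mul_sum] at this
    have hαi : 0 < α⁻¹ := inv_pos.2 hα
    nlinarith
  have hscal := fd_scalar α L e c w D hα hL hαL he0 hmin hwle h4
  -- the sum over active sets
  have hA : ∑ S : {S : Finset (Fin m) // S.card = P}, ‖(P : ℝ)⁻¹ • ∑ k ∈ S.1, z k - θs‖ ^ 2
      ≤ N * ‖γ - θs‖ ^ 2 + N / m * (2 * ∑ k, ⟪γ - θs, z k - γ⟫) + N / m * e := by
    have hS : ∀ S : {S : Finset (Fin m) // S.card = P},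
        ‖(P : ℝ)⁻¹ • ∑ k ∈ S.1, z k - θs‖ ^ 2 ≤ ‖γ - θs‖ ^ 2
          + (2 * (P : ℝ)⁻¹) * ∑ k ∈ S.1, ⟪γ - θs, z k - γ⟫
          + (P : ℝ)⁻¹ * ∑ k ∈ S.1, ‖z k - γ‖ ^ 2 := by
      intro S
      have e1 : (P : ℝ)⁻¹ • ∑ k ∈ S.1, z k - θs
          = (γ - θs) + (P : ℝ)⁻¹ • ∑ k ∈ S.1, (z k - γ) := by
        rw [Finset.sum_sub_distrib, Finset.sum_const, S.2, smul_sub, ← Nat.cast_smul_eq_nsmul ℝ,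
          inv_smul_smul₀ hP'.ne']
        abel
      have := fd_avg_sq S.1 P hP S.2 (fun k => z k - γ)
      rw [e1, norm_add_sq_real, inner_smul_right, inner_sum]
      linarith
    refine (Finset.sum_le_sum fun S _ => hS S).trans (le_of_eq ?_)
    rw [Finset.sum_add_distrib, Finset.sum_add_distrib, ← Finset.mul_sum, ← Finset.mul_sum,
      fd_sum_active m P hm, fd_sum_active m P hm, Finset.sum_const, Finset.card_univ,
      nsmul_eq_mul, smul_eq_mul, smul_eq_mul, ← hN, ← he]
    field_simp
  have hB : ∑ S : {S : Finset (Fin m) // S.card = P},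
      ∑ k, ‖(if k ∈ S.1 then gradient (Lk k) (z k) else g k) - gradient (Lk k) θs‖ ^ 2
      = N * c + N * P / m * (w - c) := by
    have hS : ∀ S : {S : Finset (Fin m) // S.card = P},
        ∑ k, ‖(if k ∈ S.1 then gradient (Lk k) (z k) else g k) - gradient (Lk k) θs‖ ^ 2
        = c + ∑ k ∈ S.1, (‖gradient (Lk k) (z k) - gradient (Lk k) θs‖ ^ 2
          - ‖g k - gradient (Lk k) θs‖ ^ 2) := by
      intro S
      have : ∑ k ∈ S.1, (‖gradient (Lk k) (z k) - gradient (Lk k) θs‖ ^ 2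
          - ‖g k - gradient (Lk k) θs‖ ^ 2) = ∑ k, if k ∈ S.1 then
            (‖gradient (Lk k) (z k) - gradient (Lk k) θs‖ ^ 2
          - ‖g k - gradient (Lk k) θs‖ ^ 2) else 0 := by simp
      rw [this, hc, ← Finset.sum_add_distrib]
      refine Finset.sum_congr rfl fun k _ => ?_
      split_ifs <;> ring
    rw [Finset.sum_congr rfl (fun S _ => hS S), Finset.sum_add_distrib, fd_sum_active m P hm,
      Finset.sum_const, Finset.card_univ, nsmul_eq_mul, smul_eq_mul, Finset.sum_sub_distrib]
  rw [Finset.sum_add_distrib, ← Finset.mul_sum, hB]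
  have hNm : 0 ≤ N / m := by positivity
  have hfin := mul_le_mul_of_nonneg_left hscal hNm
  have hinn := mul_le_mul_of_nonneg_left hinner hNm
  have e2 : 7 / 2 / α ^ 2 / P * (N * c + N * P / m * (w - c))
      = N * (7 / 2 / α ^ 2 / P * c) + N / m * (7 / 2 / α ^ 2 * (w - c)) := by
    field_simp
  have e3 : N * (‖γ - θs‖ ^ 2 + 7 / 2 / α ^ 2 / P * c - (m : ℝ)⁻¹ * D / (10 * α))
      = N * ‖γ - θs‖ ^ 2 + N * (7 / 2 / α ^ 2 / P * c) + N / m * (-(D / (10 * α))) := by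
    field_simp
    ring
  rw [e2, e3]
  linarith

end FedDynAux

/-- FedDyn convergence rate, convex case. -/
theorem feddyn_convergence_convex
    (d m P T : ℕ) (hd : 1 ≤ d) (hm : 1 ≤ m) (hP1 : 1 ≤ P) (hPm : P ≤ m) (hT : 1 ≤ T)
    (α L : ℝ) (hα : 0 < α) (hL : 0 < L) (hαL : 25 * L ≤ α)
    (Lk : Fin m → EuclideanSpace ℝ (Fin d) → ℝ)
    (hdiff : ∀ k, Differentiable ℝ (Lk k))
    (hconv : ∀ k, ConvexOn ℝ Set.univ (Lk k))
    (hsmooth : ∀ k x y, ‖gradient (Lk k) x - gradient (Lk k) y‖ ≤ L * ‖x - y‖)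
    (ℓ : EuclideanSpace ℝ (Fin d) → ℝ)
    (hℓ : ∀ x, ℓ x = (m : ℝ)⁻¹ * ∑ k, Lk k x)
    (θstar : EuclideanSpace ℝ (Fin d)) (hmin : ∀ x, ℓ θstar ≤ ℓ x)
    (θ0 : EuclideanSpace ℝ (Fin d))
    -- the FedDyn process, as functions of the random sequence of active sets
    (θ : (Fin T → {S : Finset (Fin m) // S.card = P}) → ℕ → EuclideanSpace ℝ (Fin d))
    (θdev : (Fin T → {S : Finset (Fin m) // S.card = P}) → ℕ → Fin m → EuclideanSpace ℝ (Fin d))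
    (g : (Fin T → {S : Finset (Fin m) // S.card = P}) → ℕ → Fin m → EuclideanSpace ℝ (Fin d))
    (h : (Fin T → {S : Finset (Fin m) // S.card = P}) → ℕ → EuclideanSpace ℝ (Fin d))
    (γ : (Fin T → {S : Finset (Fin m) // S.card = P}) → ℕ → EuclideanSpace ℝ (Fin d))
    (hθ0 : ∀ ω, θ ω 0 = θ0)
    (hg0 : ∀ ω k, g ω 0 k = 0)
    (hh0 : ∀ ω, h ω 0 = 0)
    -- active devices minimize the dynamically regularized local objective ...
    (hdevmin : ∀ ω (t : Fin T), ∀ k ∈ (ω t).1, ∀ x,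
      Lk k (θdev ω (t.1 + 1) k) - ⟪g ω t.1 k, θdev ω (t.1 + 1) k⟫
          + α / 2 * ‖θdev ω (t.1 + 1) k - θ ω t.1‖ ^ 2 ≤
        Lk k x - ⟪g ω t.1 k, x⟫ + α / 2 * ‖x - θ ω t.1‖ ^ 2)
    (hfoc : ∀ ω (t : Fin T), ∀ k ∈ (ω t).1,
      gradient (Lk k) (θdev ω (t.1 + 1) k) - g ω t.1 k
        + α • (θdev ω (t.1 + 1) k - θ ω t.1) = 0)
    (hgupd : ∀ ω (t : Fin T), ∀ k ∈ (ω t).1,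
      g ω (t.1 + 1) k = g ω t.1 k - α • (θdev ω (t.1 + 1) k - θ ω t.1))
    (hstaleθ : ∀ ω (t : Fin T), ∀ k ∉ (ω t).1, θdev ω (t.1 + 1) k = θdev ω t.1 k)
    (hstaleg : ∀ ω (t : Fin T), ∀ k ∉ (ω t).1, g ω (t.1 + 1) k = g ω t.1 k)
    (hhupd : ∀ ω (t : Fin T),
      h ω (t.1 + 1) = h ω t.1 - (α / m) • ∑ k ∈ (ω t).1, (θdev ω (t.1 + 1) k - θ ω t.1))
    (hθupd : ∀ ω (t : Fin T),
      θ ω (t.1 + 1) = (P : ℝ)⁻¹ • ∑ k ∈ (ω t).1, θdev ω (t.1 + 1) k - α⁻¹ • h ω (t.1 + 1))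
    (hγ0 : ∀ ω, γ ω 0 = θ0)
    (hγ : ∀ ω (t : Fin T),
      γ ω (t.1 + 1) = (P : ℝ)⁻¹ • ∑ k ∈ (ω t).1, θdev ω (t.1 + 1) k) :
    (∑ ω : (Fin T → {S : Finset (Fin m) // S.card = P}),
        (ℓ ((T : ℝ)⁻¹ • ∑ t ∈ Finset.range T, γ ω t) - ℓ θstar)) /
      (Fintype.card (Fin T → {S : Finset (Fin m) // S.card = P}) : ℝ) ≤
    (T : ℝ)⁻¹ * (10 * α * ‖θ0 - θstar‖ ^ 2 +
      100 / α * ((m : ℝ) / P) * ((m : ℝ)⁻¹ * ∑ k, ‖gradient (Lk k) θstar‖ ^ 2)) := by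
  classical
  have hm' : (0:ℝ) < m := by exact_mod_cast hm
  have hP' : (0:ℝ) < P := by exact_mod_cast hP1
  have hT' : (0:ℝ) < T := by exact_mod_cast hT
  -- stationarity
  have hG : ∑ k, gradient (Lk k) θstar = 0 := by
    refine ext_inner_right ℝ fun v => ?_
    rw [sum_inner, inner_zero_left]
    have hd1 : HasDerivAt (fun s : ℝ => ∑ k, Lk k (θstar + s • v))
        (∑ k, ⟪gradient (Lk k) θstar, v⟫) 0 :=
      HasDerivAt.fun_sum fun k _ => fd_hasDeriv (Lk k) (hdiff k) θstar v
    refine IsLocalMin.hasDerivAt_eq_zero (f := fun s : ℝ => ∑ k, Lk k (θstar + s • v)) ?_ hd1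
    refine Filter.Eventually.of_forall fun s => ?_
    have := hmin (θstar + s • v)
    rw [hℓ, hℓ] at this
    simpa using le_of_mul_le_mul_left this (inv_pos.2 hm')
  have hDsum : ∀ x, ℓ x - ℓ θstar = (m : ℝ)⁻¹ * ∑ k, (Lk k x - Lk k θstar) := by
    intro x
    rw [hℓ, hℓ, Finset.sum_sub_distrib, mul_sub]
  have hDnn : ∀ x, 0 ≤ ∑ k, (Lk k x - Lk k θstar) := by
    intro x
    have h1 : 0 ≤ ℓ x - ℓ θstar := sub_nonneg.2 (hmin x)
    rw [hDsum] at h1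
    exact nonneg_of_mul_nonneg_right h1 (inv_pos.2 hm')
  -- the new dual variable is the gradient
  have hgnew : ∀ ω (t : Fin T), ∀ k ∈ (ω t).1,
      g ω (t.1 + 1) k = gradient (Lk k) (θdev ω (t.1 + 1) k) := by
    intro ω t k hk
    rw [hgupd ω t k hk]
    have := hfoc ω t k hk
    rw [← sub_eq_zero, ← neg_eq_zero, ← this]
    abel
  -- invariants
  have hinvh : ∀ ω n, n ≤ T → h ω n = (m : ℝ)⁻¹ • ∑ k, g ω n k := by
    intro ω n
    induction n with
    | zero => intro _; simp [hh0, hg0]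
    | succ n ih =>
      intro hn
      have h1 := hhupd ω ⟨n, hn⟩
      simp only at h1
      rw [h1, ih (by omega)]
      have h2 : ∀ k, g ω (n + 1) k = g ω n k
          - (if k ∈ (ω ⟨n, hn⟩).1 then α • (θdev ω (n + 1) k - θ ω n) else 0) := by
        intro k
        split_ifs with hk
        · exact hgupd ω ⟨n, hn⟩ k hk
        · rw [sub_zero]; exact hstaleg ω ⟨n, hn⟩ k hk
      have h3 : ∑ k, g ω (n + 1) k = ∑ k, g ω n k
          - α • ∑ k ∈ (ω ⟨n, hn⟩).1, (θdev ω (n + 1) k - θ ω n) := by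
        rw [Finset.sum_congr rfl (fun k _ => h2 k), Finset.sum_sub_distrib, Finset.sum_ite_mem,
          Finset.univ_inter, ← Finset.smul_sum]
      rw [h3, smul_sub, smul_smul, inv_mul_eq_div]
  have hinvθ : ∀ ω n, n ≤ T → θ ω n = γ ω n - α⁻¹ • ((m : ℝ)⁻¹ • ∑ k, g ω n k) := by
    intro ω n hn
    rw [← hinvh ω n hn]
    cases n with
    | zero => simp [hθ0, hγ0, hh0]
    | succ n =>
      have h1 := hθupd ω ⟨n, hn⟩
      have h2 := hγ ω ⟨n, hn⟩
      simp only at h1 h2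
      rw [h1, h2]
  -- uniqueness of local solutions
  have huniq : ∀ (k : Fin m) (u v x y : EuclideanSpace ℝ (Fin d)),
      gradient (Lk k) x - u + α • (x - v) = 0 → gradient (Lk k) y - u + α • (y - v) = 0 →
      x = y := by
    intro k u v x y hx hy
    have h1 : α • (x - y) = - (gradient (Lk k) x - gradient (Lk k) y) := by
      rw [← sub_eq_zero]
      have h3 : (gradient (Lk k) x - u + α • (x - v)) - (gradient (Lk k) y - u + α • (y - v)) = 0 := by
        rw [hx, hy, sub_zero]
      rw [← h3]
      module
    have h2 := congrArg norm h1
    rw [norm_neg, norm_smul, Real.norm_eq_abs, abs_of_pos hα] at h2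
    have h3 := hsmooth k x y
    rw [← h2] at h3
    have h4 : ‖x - y‖ ≤ 0 := by
      by_contra hcon
      push Not at hcon
      nlinarith
    exact sub_eq_zero.1 (norm_le_zero_iff.1 h4)
  -- causality
  have hcaus : ∀ ω ω' n, n ≤ T → (∀ i : Fin T, i.1 < n → ω i = ω' i) →
      γ ω n = γ ω' n ∧ ∀ k, g ω n k = g ω' n k := by
    intro ω ω' n
    induction n with
    | zero => intro _ _; simp [hγ0, hg0]
    | succ n ih =>
      intro hn hag
      obtain ⟨ihγ, ihg⟩ := ih (by omega) (fun i hi => hag i (by omega))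
      have hθeq : θ ω n = θ ω' n := by
        rw [hinvθ ω n (by omega), hinvθ ω' n (by omega), ihγ,
          Finset.sum_congr rfl (fun k _ => ihg k)]
      have hωt : ω ⟨n, hn⟩ = ω' ⟨n, hn⟩ := hag ⟨n, hn⟩ (Nat.lt_succ_self n)
      have hdeveq : ∀ k ∈ (ω ⟨n, hn⟩).1, θdev ω (n + 1) k = θdev ω' (n + 1) k := by
        intro k hk
        have h1 := hfoc ω ⟨n, hn⟩ k hk
        have h2 := hfoc ω' ⟨n, hn⟩ k (hωt ▸ hk)
        simp only at h1 h2
        rw [ihg k, hθeq] at h1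
        exact huniq k _ _ _ _ h1 h2
      constructor
      · have h1 := hγ ω ⟨n, hn⟩
        have h2 := hγ ω' ⟨n, hn⟩
        simp only at h1 h2
        rw [h1, h2, ← hωt, Finset.sum_congr rfl hdeveq]
      · intro k
        by_cases hk : k ∈ (ω ⟨n, hn⟩).1
        · have h1 := hgnew ω ⟨n, hn⟩ k hk
          have h2 := hgnew ω' ⟨n, hn⟩ k (hωt ▸ hk)
          simp only at h1 h2
          rw [h1, h2, hdeveq k hk]
        · have h1 := hstaleg ω ⟨n, hn⟩ k hk
          have h2 := hstaleg ω' ⟨n, hn⟩ k (hωt ▸ hk)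
          simp only at h1 h2
          rw [h1, h2, ihg k]
  have hex : ∀ k : Fin m, ∃ S : {S : Finset (Fin m) // S.card = P}, k ∈ S.1 := by
    intro k
    obtain ⟨S, hS1, _, hS2⟩ := Finset.exists_subsuperset_card_eq
      (s := {k}) (t := Finset.univ) (n := P) (Finset.subset_univ _) (by simpa using hP1)
      (by simpa using hPm)
    exact ⟨⟨S, hS2⟩, hS1 (Finset.mem_singleton_self k)⟩
  choose Sk hSk using hex
  have hne : Nonempty {S : Finset (Fin m) // S.card = P} := ⟨Sk ⟨0, hm⟩⟩
  -- Lyapunov function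
  obtain ⟨V, hV⟩ : ∃ V : (Fin T → {S : Finset (Fin m) // S.card = P}) → ℕ → ℝ, ∀ ω n,
      V ω n = ‖γ ω n - θstar‖ ^ 2
        + 7 / 2 / α ^ 2 / P * ∑ k, ‖g ω n k - gradient (Lk k) θstar‖ ^ 2 := ⟨_, fun _ _ => rfl⟩
  have hstep : ∀ n, n < T →
      ∑ ω, V ω (n + 1) ≤ ∑ ω, (V ω n - (ℓ (γ ω n) - ℓ θstar) / (10 * α)) := by
    intro n hn
    have hN : (0:ℝ) < Fintype.card {S : Finset (Fin m) // S.card = P} := by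
      exact_mod_cast Fintype.card_pos
    refine le_of_mul_le_mul_left ?_ hN
    rw [← fd_resample (⟨n, hn⟩ : Fin T) (fun ω => V ω (n + 1)), Finset.mul_sum]
    refine Finset.sum_le_sum fun ω _ => ?_
    have hupd : ∀ S, γ ω n = γ (Function.update ω ⟨n, hn⟩ S) n ∧
        ∀ k, g ω n k = g (Function.update ω ⟨n, hn⟩ S) n k := by
      intro S
      refine hcaus _ _ n hn.le fun i hi => ?_
      rw [Function.update_of_ne]
      intro hi'
      rw [hi'] at hi
      exact lt_irrefl _ hi
    have hfoc' : ∀ S, ∀ k ∈ S.1,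
        gradient (Lk k) (θdev (Function.update ω ⟨n, hn⟩ S) (n + 1) k) - g ω n k
          + α • (θdev (Function.update ω ⟨n, hn⟩ S) (n + 1) k
            - (γ ω n - α⁻¹ • ((m : ℝ)⁻¹ • ∑ j, g ω n j))) = 0 := by
      intro S k hk
      have h1 := hfoc (Function.update ω ⟨n, hn⟩ S) ⟨n, hn⟩ k (by simpa using hk)
      simp only at h1
      rw [hinvθ _ n hn.le, ← (hupd S).1, ← (hupd S).2 k,
        Finset.sum_congr rfl (fun j _ => ((hupd S).2 j).symm)] at h1
      exact h1
    obtain ⟨z, hzdef⟩ : ∃ z : Fin m → EuclideanSpace ℝ (Fin d), ∀ k,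
        z k = θdev (Function.update ω ⟨n, hn⟩ (Sk k)) (n + 1) k := ⟨_, fun _ => rfl⟩
    have hz : ∀ k, gradient (Lk k) (z k) - g ω n k
        + α • (z k - (γ ω n - α⁻¹ • ((m : ℝ)⁻¹ • ∑ j, g ω n j))) = 0 := by
      intro k
      rw [hzdef]
      exact hfoc' (Sk k) k (hSk k)
    have hzS : ∀ S, ∀ k ∈ S.1, θdev (Function.update ω ⟨n, hn⟩ S) (n + 1) k = z k :=
      fun S k hk => huniq k _ _ _ _ (hfoc' S k hk) (hz k)
    have hone := fd_one_step m P hm hP1 α L hα hL hαL Lk hdiff hconv hsmooth θstar (γ ω n) hG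
      (hDnn _) (g ω n) z hz
    rw [hV ω n, hDsum]
    refine le_of_eq_of_le (Finset.sum_congr rfl fun S _ => ?_) hone
    rw [hV]
    have h1 := hγ (Function.update ω ⟨n, hn⟩ S) ⟨n, hn⟩
    simp only [Function.update_self] at h1
    rw [h1, Finset.sum_congr rfl (hzS S)]
    congr 2
    refine Finset.sum_congr rfl fun k _ => ?_
    split_ifs with hk
    · have h2 := hgnew (Function.update ω ⟨n, hn⟩ S) ⟨n, hn⟩ k (by simpa using hk)
      simp only at h2
      rw [h2, hzS S k hk]
    · have h2 := hstaleg (Function.update ω ⟨n, hn⟩ S) ⟨n, hn⟩ k (by simpa using hk)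
      simp only at h2
      rw [h2, ← (hupd S).2 k]
  have htel : ∀ n, n ≤ T → ∑ ω, V ω n
      + (∑ ω, ∑ t ∈ Finset.range n, (ℓ (γ ω t) - ℓ θstar)) / (10 * α) ≤ ∑ ω, V ω 0 := by
    intro n
    induction n with
    | zero => intro _; simp
    | succ n ih =>
      intro hn
      have h1 := ih (by omega)
      have h2 := hstep n hn
      rw [Finset.sum_sub_distrib, ← Finset.sum_div] at h2
      simp only [Finset.sum_range_succ, Finset.sum_add_distrib (s := Finset.univ)]
      rw [add_div]
      linarith
  have hVT : 0 ≤ ∑ ω, V ω T := Finset.sum_nonneg fun ω _ => by rw [hV]; positivity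
  have hfinal := htel T le_rfl
  have hℓconv : ConvexOn ℝ Set.univ ℓ := by
    refine ⟨convex_univ, fun x _ y _ a b ha hb hab => ?_⟩
    rw [hℓ, hℓ, hℓ]
    have : ∑ k, Lk k (a • x + b • y) ≤ ∑ k, (a * Lk k x + b * Lk k y) :=
      Finset.sum_le_sum fun k _ => (hconv k).2 (Set.mem_univ x) (Set.mem_univ y) ha hb hab
    rw [Finset.sum_add_distrib, ← Finset.mul_sum, ← Finset.mul_sum] at this
    have := mul_le_mul_of_nonneg_left this (inv_pos.2 hm').le
    simp only [smul_eq_mul]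
    linarith
  have hjensen : ∀ ω, ℓ ((T : ℝ)⁻¹ • ∑ t ∈ Finset.range T, γ ω t) - ℓ θstar
      ≤ (T : ℝ)⁻¹ * ∑ t ∈ Finset.range T, (ℓ (γ ω t) - ℓ θstar) := by
    intro ω
    have := hℓconv.map_sum_le (t := Finset.range T) (w := fun _ => (T : ℝ)⁻¹) (p := γ ω)
      (fun _ _ => (inv_pos.2 hT').le) (by simp [hT'.ne']) (fun _ _ => Set.mem_univ _)
    rw [← Finset.smul_sum, ← Finset.smul_sum, smul_eq_mul] at this
    rw [Finset.sum_sub_distrib, mul_sub]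
    simp only [Finset.sum_const, Finset.card_range, nsmul_eq_mul]
    rw [inv_mul_cancel_left₀ hT'.ne']
    linarith
  have hC : (0:ℝ) < Fintype.card (Fin T → {S : Finset (Fin m) // S.card = P}) := by
    exact_mod_cast Fintype.card_pos
  rw [div_le_iff₀ hC]
  have hV0 : ∑ ω, V ω 0 = (Fintype.card (Fin T → {S : Finset (Fin m) // S.card = P}) : ℝ)
      * (‖θ0 - θstar‖ ^ 2 + 7 / 2 / α ^ 2 / P * ∑ k, ‖gradient (Lk k) θstar‖ ^ 2) := by
    simp only [hV, hγ0, hg0, zero_sub, norm_neg, Finset.sum_const, Finset.card_univ, nsmul_eq_mul]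
  rw [hV0] at hfinal
  set C : ℝ := (Fintype.card (Fin T → {S : Finset (Fin m) // S.card = P}) : ℝ) with hCdef
  set Q := ∑ k, ‖gradient (Lk k) θstar‖ ^ 2 with hQ
  have hQ0 : 0 ≤ Q := Finset.sum_nonneg fun k _ => sq_nonneg _
  set R := ∑ ω, ∑ t ∈ Finset.range T, (ℓ (γ ω t) - ℓ θstar) with hR
  have hRle : R ≤ (10 * α * ‖θ0 - θstar‖ ^ 2 + 100 / α * ((m : ℝ) / P) * ((m : ℝ)⁻¹ * Q)) * C := by
    have h1 : R / (10 * α) ≤ C * (‖θ0 - θstar‖ ^ 2 + 7 / 2 / α ^ 2 / P * Q) := by linarith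
    rw [div_le_iff₀ (by positivity)] at h1
    refine h1.trans ?_
    have e1 : C * (‖θ0 - θstar‖ ^ 2 + 7 / 2 / α ^ 2 / P * Q) * (10 * α)
        = (10 * α * ‖θ0 - θstar‖ ^ 2 + 35 / α / P * Q) * C := by
      field_simp
      ring
    have e2 : 100 / α * ((m : ℝ) / P) * ((m : ℝ)⁻¹ * Q) = 100 / α / P * Q := by
      field_simp
    rw [e1, e2]
    gcongr
    norm_num
  calc _ ≤ ∑ ω, (T : ℝ)⁻¹ * ∑ t ∈ Finset.range T, (ℓ (γ ω t) - ℓ θstar) :=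
        Finset.sum_le_sum fun ω _ => hjensen ω
    _ = (T : ℝ)⁻¹ * R := by rw [← Finset.mul_sum]
    _ ≤ (T : ℝ)⁻¹ * ((10 * α * ‖θ0 - θstar‖ ^ 2
          + 100 / α * ((m : ℝ) / P) * ((m : ℝ)⁻¹ * Q)) * C) := by gcongr
    _ = _ := by ring
end

section
/- Under the FedDyn process with each L_k additionally μ-strongly convex for some μ > 0 and with θ* the global minimizer of ℓ, if α ≥ max( 5·(m/P)·μ , 30·L ), then with r = 1 + μ/α and R = ∑_{t=0}^{T−1} r^t, the r-weighted average of the active-device averages satisfies E[ ℓ( (1/R) ∑_{t=0}^{T−1} r^t γ^t ) − ℓ(θ*) ] ≤ (1/r^{T−1}) · ( 20·α·‖θ^0 − θ*‖² + (400/α)·(m/P) · (1/m) ∑_{k=1}^m ‖∇L_k(θ*)‖² ). -/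
open scoped RealInnerProductSpace

namespace FedDynAux

/-- Telescoping of a potential along a random process driven by i.i.d. uniform choices. -/
lemma telescope {A S : Type*} [Fintype A] (step : S → A → S) (V D : S → ℝ) (r : ℝ) (hr : 0 ≤ r)
    (hV : ∀ s, 0 ≤ V s)
    (hstep : ∀ s, (Fintype.card A : ℝ) * D s + r * ∑ a, V (step s a) ≤ Fintype.card A * V s) :
    ∀ (n : ℕ) (s0 : S) (X : (Fin n → A) → ℕ → S), (∀ ω, X ω 0 = s0) →
      (∀ ω (t : Fin n), X ω (t.1 + 1) = step (X ω t.1) (ω t)) →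
      ∑ ω, ∑ t ∈ Finset.range n, r ^ t * D (X ω t) ≤ (Fintype.card A : ℝ) ^ n * V s0 := by
  intro n
  induction n with
  | zero => intro s0 X _ _; simpa using hV s0
  | succ n ih =>
    intro s0 X h0 hs
    have key : ∀ a, ∑ ω : Fin n → A, ∑ t ∈ Finset.range n,
        r ^ t * D (X (Fin.cons a ω : Fin (n + 1) → A) (t + 1)) ≤
          (Fintype.card A : ℝ) ^ n * V (step s0 a) := by
      intro a
      refine ih (step s0 a) (fun ω t => X (Fin.cons a ω : Fin (n + 1) → A) (t + 1)) ?_ ?_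
      · intro ω
        have := hs (Fin.cons a ω : Fin (n + 1) → A) 0
        simpa [h0] using this
      · intro ω t
        have := hs (Fin.cons a ω : Fin (n + 1) → A) t.succ
        simpa using this
    rw [← (Fin.consEquiv (fun _ : Fin (n + 1) => A)).sum_comp, Fintype.sum_prod_type]
    have e1 : ∀ a (ω : Fin n → A), ∑ t ∈ Finset.range (n + 1),
        r ^ t * D (X ((Fin.consEquiv (fun _ : Fin (n + 1) => A)) (a, ω)) t) =
        D s0 + r * ∑ t ∈ Finset.range n,
          r ^ t * D (X (Fin.cons a ω : Fin (n + 1) → A) (t + 1)) := by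
      intro a ω
      rw [Finset.sum_range_succ', Finset.mul_sum, add_comm]
      simp [h0, pow_succ, Fin.consEquiv]
      refine Finset.sum_congr rfl fun t _ => by ring
    simp_rw [e1, Finset.sum_add_distrib, ← Finset.mul_sum]
    have h2 : ∑ a, ∑ ω : Fin n → A, ∑ t ∈ Finset.range n,
        r ^ t * D (X (Fin.cons a ω : Fin (n + 1) → A) (t + 1)) ≤
        (Fintype.card A : ℝ) ^ n * ∑ a, V (step s0 a) := by
      rw [Finset.mul_sum]
      exact Finset.sum_le_sum fun a _ => key a
    have h3 := mul_le_mul_of_nonneg_left h2 hr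
    have h4 := mul_le_mul_of_nonneg_left (hstep s0)
      (by positivity : (0 : ℝ) ≤ (Fintype.card A : ℝ) ^ n)
    simp only [Finset.sum_const, Finset.card_univ, nsmul_eq_mul, Fintype.card_fun,
      Fintype.card_fin, Nat.cast_pow]
    rw [pow_succ]
    nlinarith

/-- Averages over uniformly random `P`-subsets. -/
lemma sum_subsets (m P : ℕ) (f : Fin m → ℝ) :
    (m : ℝ) * ∑ S : {S : Finset (Fin m) // S.card = P}, ∑ k ∈ S.1, f k =
      (Fintype.card {S : Finset (Fin m) // S.card = P} : ℝ) * P * ∑ k, f k := by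
  classical
  set N : Fin m → ℝ := fun k => ∑ S : {S : Finset (Fin m) // S.card = P},
    if k ∈ S.1 then (1 : ℝ) else 0 with hN
  have h1 : ∀ f : Fin m → ℝ, ∑ S : {S : Finset (Fin m) // S.card = P}, ∑ k ∈ S.1, f k
      = ∑ k, N k * f k := by
    intro f
    have : ∀ S : {S : Finset (Fin m) // S.card = P}, ∑ k ∈ S.1, f k =
        ∑ k, (if k ∈ S.1 then (1 : ℝ) else 0) * f k := by
      intro S; simp [Finset.sum_ite_mem]
    simp_rw [this]
    rw [Finset.sum_comm]
    simp_rw [hN, Finset.sum_mul]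
  have h2 : ∀ i j, N i = N j := by
    intro i j
    let e : {S : Finset (Fin m) // S.card = P} ≃ {S : Finset (Fin m) // S.card = P} :=
      (Equiv.swap i j).finsetCongr.subtypeEquiv (by intro S; simp)
    simp only [hN]
    rw [← e.sum_comp]
    refine Finset.sum_congr rfl fun S _ => ?_
    have : i ∈ (e S).1 ↔ j ∈ S.1 := by
      simp [e, Finset.mem_map_equiv, Equiv.finsetCongr_apply]
    simp [this]
  have h3 := h1 (fun _ => 1)
  have h4 : ∀ S : {S : Finset (Fin m) // S.card = P}, ∑ k ∈ S.1, (1 : ℝ) = P := by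
    intro S; simp [S.2]
  simp_rw [h4] at h3
  simp only [Finset.sum_const, Finset.card_univ, nsmul_eq_mul, mul_one] at h3
  rw [h1, Finset.mul_sum, h3, Finset.mul_sum]
  refine Finset.sum_congr rfl fun k _ => ?_
  rw [Finset.sum_congr rfl (fun i _ => h2 i k)]
  simp
  ring

variable {E : Type*} [NormedAddCommGroup E] [InnerProductSpace ℝ E]

lemma descent {f : E → ℝ} {G : E → E} {L μ : ℝ} (hμ : 0 < μ)
    (hsc : ∀ x y, f x + ⟪G x, y - x⟫ + μ / 2 * ‖y - x‖ ^ 2 ≤ f y)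
    (hsm : ∀ x y, ‖G x - G y‖ ≤ L * ‖x - y‖) (x y : E) :
    f y ≤ f x + ⟪G x, y - x⟫ + L * ‖y - x‖ ^ 2 := by
  have h1 := hsc y x
  have h2 : ⟪G y - G x, y - x⟫ ≤ L * ‖y - x‖ ^ 2 := by
    refine (real_inner_le_norm _ _).trans ?_
    have := mul_le_mul_of_nonneg_right (hsm y x) (norm_nonneg (y - x))
    nlinarith
  have h3 : ⟪G y, x - y⟫ = - ⟪G y, y - x⟫ := by rw [← inner_neg_right, neg_sub]
  rw [inner_sub_left] at h2
  have : 0 ≤ μ / 2 * ‖x - y‖ ^ 2 := by positivity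
  linarith

lemma coco {f : E → ℝ} {G : E → E} {L μ : ℝ} (hL : 0 < L) (hμ : 0 < μ)
    (hsc : ∀ x y, f x + ⟪G x, y - x⟫ + μ / 2 * ‖y - x‖ ^ 2 ≤ f y)
    (hsm : ∀ x y, ‖G x - G y‖ ≤ L * ‖x - y‖) (x y : E) :
    ‖G y - G x‖ ^ 2 ≤ 4 * L * (f y - f x - ⟪G x, y - x⟫) := by
  set δ := G y - G x with hδ
  set z := y - (1 / (2 * L)) • δ with hz
  have h1 := hsc x z
  have h2 := descent hμ hsc hsm y z
  have h0 : 0 ≤ μ / 2 * ‖z - x‖ ^ 2 := by positivity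
  have e1 : z - y = - ((1 / (2 * L)) • δ) := by rw [hz]; abel
  have e2 : ⟪G x, z - x⟫ = ⟪G x, y - x⟫ + ⟪G x, z - y⟫ := by
    rw [← inner_add_right]; congr 1; abel
  have e3 : ⟪G y, z - y⟫ - ⟪G x, z - y⟫ = - (1 / (2 * L)) * ‖δ‖ ^ 2 := by
    rw [← inner_sub_left, ← hδ, e1, inner_neg_right, inner_smul_right, real_inner_self_eq_norm_sq]
    ring
  have e4 : ‖z - y‖ ^ 2 = (1 / (2 * L)) ^ 2 * ‖δ‖ ^ 2 := by
    rw [e1, norm_neg, norm_smul, mul_pow, Real.norm_eq_abs, sq_abs]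
  rw [e4] at h2
  have h5 : (1 / (2 * L)) * ‖δ‖ ^ 2 - L * ((1 / (2 * L)) ^ 2 * ‖δ‖ ^ 2) ≤
      f y - f x - ⟪G x, y - x⟫ := by linarith
  have e5 : (1 / (2 * L)) * ‖δ‖ ^ 2 - L * ((1 / (2 * L)) ^ 2 * ‖δ‖ ^ 2) = ‖δ‖ ^ 2 / (4 * L) := by
    field_simp; ring
  rw [e5, div_le_iff₀ (by positivity)] at h5
  linarith

lemma norm_add3_sq {E : Type*} [NormedAddCommGroup E] (a b c : E) : ‖a + b + c‖ ^ 2 ≤ 3 * (‖a‖ ^ 2 + ‖b‖ ^ 2 + ‖c‖ ^ 2) := by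
  have h := norm_add₃_le (a := a) (b := b) (c := c)
  have h' : ‖a + b + c‖ ^ 2 ≤ (‖a‖ + ‖b‖ + ‖c‖) ^ 2 := by gcongr
  nlinarith [sq_nonneg (‖a‖ - ‖b‖), sq_nonneg (‖a‖ - ‖c‖), sq_nonneg (‖b‖ - ‖c‖)]

lemma norm_add2_sq {E : Type*} [NormedAddCommGroup E] (a b : E) : ‖a + b‖ ^ 2 ≤ 2 * (‖a‖ ^ 2 + ‖b‖ ^ 2) := by
  have h := norm_add_le a b
  have h' : ‖a + b‖ ^ 2 ≤ (‖a‖ + ‖b‖) ^ 2 := by gcongr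
  nlinarith [sq_nonneg (‖a‖ - ‖b‖)]

/-- Jensen for the squared distance. -/
lemma jensen_sq {m : ℕ} (S : Finset (Fin m)) (P : ℕ) (hP : 1 ≤ P) (hS : S.card = P)
    (x : Fin m → E) (z : E) :
    ‖(P : ℝ)⁻¹ • ∑ k ∈ S, x k - z‖ ^ 2 ≤ (P : ℝ)⁻¹ * ∑ k ∈ S, ‖x k - z‖ ^ 2 := by
  have hP' : (0 : ℝ) < P := by exact_mod_cast hP
  have e : (P : ℝ)⁻¹ • ∑ k ∈ S, x k - z = (P : ℝ)⁻¹ • ∑ k ∈ S, (x k - z) := by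
    rw [Finset.sum_sub_distrib, Finset.sum_const, hS, smul_sub, ← Nat.cast_smul_eq_nsmul ℝ,
      smul_smul, inv_mul_cancel₀ hP'.ne', one_smul]
  rw [e, norm_smul, mul_pow, Real.norm_eq_abs, sq_abs]
  have h1 : ‖∑ k ∈ S, (x k - z)‖ ^ 2 ≤ (∑ k ∈ S, ‖x k - z‖) ^ 2 := by
    gcongr; exact norm_sum_le _ _
  have h2 := sq_sum_le_card_mul_sum_sq (s := S) (f := fun k => ‖x k - z‖)
  rw [hS] at h2
  calc _ ≤ ((P : ℝ)⁻¹) ^ 2 * (P * ∑ k ∈ S, ‖x k - z‖ ^ 2) := by gcongr; exact h1.trans h2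
    _ = _ := by field_simp

/-- Variance is at most second moment. -/
lemma var_le {m : ℕ} (hm : 1 ≤ m) (u : Fin m → E) :
    ∑ k, ‖u k - (m : ℝ)⁻¹ • ∑ j, u j‖ ^ 2 ≤ ∑ k, ‖u k‖ ^ 2 := by
  have hm' : (0 : ℝ) < m := by exact_mod_cast hm
  set s := (m : ℝ)⁻¹ • ∑ j, u j with hs
  have hsum : ∑ j, u j = (m : ℝ) • s := by
    rw [hs, smul_smul, mul_inv_cancel₀ hm'.ne', one_smul]
  simp_rw [norm_sub_sq_real, Finset.sum_add_distrib, Finset.sum_sub_distrib, ← Finset.mul_sum,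
    ← sum_inner, hsum, inner_smul_left, real_inner_self_eq_norm_sq]
  simp
  nlinarith [mul_nonneg hm'.le (sq_nonneg ‖s‖)]

/-- Existence and uniqueness of the proximal point. -/
lemma prox_exists [CompleteSpace E] {G : E → E} {L α : ℝ} (hL : 0 < L) (hα : 30 * L ≤ α)
    (hsm : ∀ x y, ‖G x - G y‖ ≤ L * ‖x - y‖) (g θ : E) :
    ∃ x, G x - g + α • (x - θ) = 0 ∧ ∀ y, G y - g + α • (y - θ) = 0 → y = x := by
  have hα0 : 0 < α := by linarith
  have hc : ContractingWith (1 / 2) (fun x => θ + α⁻¹ • (g - G x)) := by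
    refine ⟨by norm_num, LipschitzWith.of_dist_le_mul fun x y => ?_⟩
    rw [dist_eq_norm, dist_eq_norm]
    have : θ + α⁻¹ • (g - G x) - (θ + α⁻¹ • (g - G y)) = α⁻¹ • (G y - G x) := by
      rw [add_sub_add_left_eq_sub, ← smul_sub]; congr 1; abel
    rw [this, norm_smul, Real.norm_eq_abs, abs_of_pos (by positivity), norm_sub_rev]
    have h1 := hsm x y
    have h2 : ((1 / 2 : NNReal) : ℝ) = 1 / 2 := by norm_num
    rw [h2, inv_mul_le_iff₀ hα0]
    nlinarith [norm_nonneg (x - y)]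
  have hfix : ∀ x, G x - g + α • (x - θ) = 0 ↔ θ + α⁻¹ • (g - G x) = x := by
    intro x
    constructor
    · intro h
      have h1 : g - G x = α • (x - θ) := by
        rw [← sub_eq_zero, ← neg_eq_zero, ← h]; abel
      rw [h1, smul_smul, inv_mul_cancel₀ hα0.ne', one_smul]; abel
    · intro h
      have h1 : x - θ = α⁻¹ • (g - G x) := by
        conv_lhs => rw [← h]
        abel
      rw [h1, smul_smul, mul_inv_cancel₀ hα0.ne', one_smul]; abel
  refine ⟨hc.fixedPoint, (hfix _).2 hc.fixedPoint_isFixedPt, fun y hy => ?_⟩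
  exact hc.fixedPoint_unique ((hfix y).1 hy)


lemma arith {A e C W B M α L μ p r κ : ℝ} (hα : 0 < α) (hL : 0 < L)
    (hp : 0 < p) (hμp : 5 * μ ≤ p * α) (hp1 : p ≤ 1) (hLα : 30 * L ≤ α) (hr : r = 1 + μ / α)
    (hμ : 0 < μ)
    (hκ : κ = 41 / 10 / (p * α ^ 2)) (he : 0 ≤ e) (hC : 0 ≤ C) (hW : 0 ≤ W) (hB : 0 ≤ B)
    (ha : α * (A - M - e) ≤ -2 * (W - L * e + μ / 2 * A))
    (hb : α ^ 2 * e ≤ 3 * C + 3 * L ^ 2 * e + 12 * L * W)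
    (hc : B ≤ 8 * L * W + 2 * L ^ 2 * e) :
    W / (5 * α) + r * (A + κ * (C + p * (B - C))) ≤ M + κ * C := by
  obtain ⟨l, rfl⟩ : ∃ l, L = l * α := ⟨L / α, by field_simp⟩
  obtain ⟨c, rfl⟩ : ∃ c, C = c * α ^ 2 := ⟨C / α ^ 2, by field_simp⟩
  obtain ⟨b, rfl⟩ : ∃ b, B = b * α ^ 2 := ⟨B / α ^ 2, by field_simp⟩
  obtain ⟨w, rfl⟩ : ∃ w, W = w * α := ⟨W / α, by field_simp⟩
  obtain ⟨q, rfl⟩ : ∃ q, μ = q * α := ⟨μ / α, by field_simp⟩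
  have hα2 : 0 < α ^ 2 := by positivity
  have hl0 : 0 < l := pos_of_mul_pos_left hL hα.le
  have hq0 : 0 < q := pos_of_mul_pos_left hμ hα.le
  have hc0 : 0 ≤ c := nonneg_of_mul_nonneg_left hC hα2
  have hb0 : 0 ≤ b := nonneg_of_mul_nonneg_left hB hα2
  have hw0 : 0 ≤ w := nonneg_of_mul_nonneg_left hW hα
  have hl : 30 * l ≤ 1 := le_of_mul_le_mul_right (by linarith) hα
  have hq : 5 * q ≤ p := le_of_mul_le_mul_right (by linarith) hα
  have ha' : (1 + q) * A ≤ M + (1 + 2 * l) * e - 2 * w :=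
    le_of_mul_le_mul_right (by linarith) hα
  have hb' : e ≤ 3 * c + 3 * l ^ 2 * e + 12 * l * w :=
    le_of_mul_le_mul_right (by linarith) hα2
  have hc' : b ≤ 8 * l * w + 2 * l ^ 2 * e :=
    le_of_mul_le_mul_right (by linarith) hα2
  have hr' : r = 1 + q := by rw [hr]; field_simp
  have hlw : l * w ≤ w / 30 := by nlinarith
  have hle : l * e ≤ e / 30 := by nlinarith
  have hlle : l ^ 2 * e ≤ e / 900 := by nlinarith
  have e1 : w * α / (5 * α) = w / 5 := by field_simp
  have e2 : κ * (c * α ^ 2) = 41 / 10 * c / p := by rw [hκ]; field_simp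
  have e3 : κ * (p * (b * α ^ 2 - c * α ^ 2)) = 41 / 10 * (b - c) := by rw [hκ]; field_simp
  rw [e1, mul_add κ, e2, e3, hr']
  have h5 : (1 + q) * (1 - p) ≤ 1 - 4 / 5 * p := by nlinarith
  have h6 : (1 + q) * (1 - p) * c / p ≤ c / p - 4 / 5 * c := by
    rw [div_le_iff₀ hp]
    have : (c / p - 4 / 5 * c) * p = (1 - 4 / 5 * p) * c := by field_simp
    rw [this]; gcongr
  have e4 : (1 + q) * (41 / 10 * c / p + 41 / 10 * (b - c)) =
      41 / 10 * ((1 + q) * (1 - p) * c / p) + 41 / 10 * ((1 + q) * b) := by field_simp; ring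
  have h7 : (1 + q) * b ≤ 6 / 5 * b := by
    gcongr; linarith
  rw [mul_add (1 + q) A, e4]
  have e5 : 41 / 10 * c / p = 41 / 10 * (c / p) := by ring
  rw [e5]
  linarith

lemma one_step {m : ℕ} (hm : 1 ≤ m) {f : Fin m → E → ℝ} {G : Fin m → E → E}
    {L μ α p r κ : ℝ} (hα : 0 < α) (hL : 0 < L) (hμ : 0 < μ)
    (hp : 0 < p) (hμp : 5 * μ ≤ p * α) (hp1 : p ≤ 1) (hLα : 30 * L ≤ α) (hr : r = 1 + μ / α)
    (hκ : κ = 41 / 10 / (p * α ^ 2))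
    (hsc : ∀ k x y, f k x + ⟪G k x, y - x⟫ + μ / 2 * ‖y - x‖ ^ 2 ≤ f k y)
    (hsm : ∀ k x y, ‖G k x - G k y‖ ≤ L * ‖x - y‖) (θs : E)
    (hmin : ∀ x, ∑ k, f k θs ≤ ∑ k, f k x) (hG : ∑ k, G k θs = 0)
    (γ : E) (g x : Fin m → E)
    (hx : ∀ k, G k (x k) - g k + α • (x k - (γ - α⁻¹ • (m : ℝ)⁻¹ • ∑ j, g j)) = 0) :
    (∑ k, f k γ - ∑ k, f k θs) / (5 * α) +
      r * (∑ k, ‖x k - θs‖ ^ 2 + κ * (∑ k, ‖g k - G k θs‖ ^ 2 +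
        p * (∑ k, ‖G k (x k) - G k θs‖ ^ 2 - ∑ k, ‖g k - G k θs‖ ^ 2))) ≤
      m * ‖γ - θs‖ ^ 2 + κ * ∑ k, ‖g k - G k θs‖ ^ 2 := by
  have hm' : (0 : ℝ) < m := by exact_mod_cast hm
  set h := (m : ℝ)⁻¹ • ∑ j, g j with hh
  have hxs : ∀ k, α • (x k - γ) = g k - h - G k (x k) := by
    intro k
    have h1 : α • (x k - (γ - α⁻¹ • h)) = α • (x k - γ) + h := by
      rw [show x k - (γ - α⁻¹ • h) = (x k - γ) + α⁻¹ • h by abel, smul_add, smul_smul,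
        mul_inv_cancel₀ hα.ne', one_smul]
    have h2 := hx k
    rw [h1] at h2
    rw [← sub_eq_zero, ← h2]; abel
  have hcoco : ∑ k, ‖G k γ - G k θs‖ ^ 2 ≤ 4 * L * (∑ k, f k γ - ∑ k, f k θs) := by
    have h1 : ∑ k, ‖G k γ - G k θs‖ ^ 2 ≤
        ∑ k, 4 * L * (f k γ - f k θs - ⟪G k θs, γ - θs⟫) :=
      Finset.sum_le_sum fun k _ => coco hL hμ (hsc k) (hsm k) θs γ
    rw [← Finset.mul_sum, Finset.sum_sub_distrib, Finset.sum_sub_distrib, ← sum_inner, hG,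
      inner_zero_left, sub_zero] at h1
    exact h1
  have hlip : ∀ k, ‖G k (x k) - G k γ‖ ^ 2 ≤ L ^ 2 * ‖x k - γ‖ ^ 2 := by
    intro k
    rw [← mul_pow]
    gcongr
    exact hsm k _ _
  refine arith (e := ∑ k, ‖x k - γ‖ ^ 2) hα hL hp hμp hp1 hLα hr hμ hκ
    (by positivity) (by positivity) (sub_nonneg.2 (hmin γ)) (by positivity) ?_ ?_ ?_
  · have hterm : ∀ k, f k γ - f k θs - L * ‖x k - γ‖ ^ 2 + μ / 2 * ‖x k - θs‖ ^ 2 ≤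
        ⟪γ - θs, G k (x k)⟫ := by
      intro k
      have h1 := descent hμ (hsc k) (hsm k) (x k) γ
      have h2 := hsc k (x k) θs
      rw [norm_sub_rev θs] at h2
      rw [norm_sub_rev γ (x k)] at h1
      have h3 : ⟪γ - θs, G k (x k)⟫ = ⟪G k (x k), γ - x k⟫ - ⟪G k (x k), θs - x k⟫ := by
        rw [← inner_sub_right, real_inner_comm]; congr 1; abel
      linarith
    have hs := Finset.sum_le_sum fun k (_ : k ∈ Finset.univ) => hterm k
    rw [Finset.sum_add_distrib, Finset.sum_sub_distrib, Finset.sum_sub_distrib, ← Finset.mul_sum,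
      ← Finset.mul_sum, ← inner_sum] at hs
    have hsumx : ∑ k, G k (x k) = - α • ∑ k, (x k - γ) := by
      have h1 : ∑ k, α • (x k - γ) = ∑ k, (g k - h - G k (x k)) :=
        Finset.sum_congr rfl fun k _ => hxs k
      rw [Finset.sum_sub_distrib, Finset.sum_sub_distrib, Finset.sum_const, ← Finset.smul_sum] at h1
      have h2 : Finset.card (Finset.univ : Finset (Fin m)) • h = ∑ k, g k := by
        rw [hh, ← Nat.cast_smul_eq_nsmul ℝ, smul_smul, Finset.card_univ, Fintype.card_fin,
          mul_inv_cancel₀ hm'.ne', one_smul]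
      rw [h2, sub_self, zero_sub] at h1
      rw [neg_smul, h1, neg_neg]
    rw [hsumx, neg_smul, inner_neg_right, inner_smul_right] at hs
    have hA : ∑ k, ‖x k - θs‖ ^ 2 =
        ∑ k, ‖x k - γ‖ ^ 2 + 2 * ⟪γ - θs, ∑ k, (x k - γ)⟫ + m * ‖γ - θs‖ ^ 2 := by
      have : ∀ k, ‖x k - θs‖ ^ 2 =
          ‖x k - γ‖ ^ 2 + 2 * ⟪γ - θs, x k - γ⟫ + ‖γ - θs‖ ^ 2 := by
        intro k
        rw [show x k - θs = (x k - γ) + (γ - θs) by abel, norm_add_sq_real, real_inner_comm]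
      simp_rw [this, Finset.sum_add_distrib, ← Finset.mul_sum, ← inner_sum]
      simp
    have : ∑ k, ‖x k - θs‖ ^ 2 - m * ‖γ - θs‖ ^ 2 - ∑ k, ‖x k - γ‖ ^ 2 =
        2 * ⟪γ - θs, ∑ k, (x k - γ)⟫ := by linarith
    rw [this]
    linarith
  · have hvar := var_le hm (fun k => g k - G k θs)
    have hs : (m : ℝ)⁻¹ • ∑ k, (g k - G k θs) = h := by
      rw [Finset.sum_sub_distrib, hG, sub_zero]
    simp only [hs] at hvar
    have hterm : ∀ k, α ^ 2 * ‖x k - γ‖ ^ 2 ≤ 3 * ‖g k - G k θs - h‖ ^ 2 +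
        3 * L ^ 2 * ‖x k - γ‖ ^ 2 + 3 * ‖G k γ - G k θs‖ ^ 2 := by
      intro k
      have h1 : α ^ 2 * ‖x k - γ‖ ^ 2 = ‖α • (x k - γ)‖ ^ 2 := by
        rw [norm_smul, mul_pow, Real.norm_eq_abs, sq_abs]
      have h2 : α • (x k - γ) =
          (g k - G k θs - h) + -(G k (x k) - G k γ) + -(G k γ - G k θs) := by
        rw [hxs]; abel
      have h3 := norm_add3_sq (g k - G k θs - h) (-(G k (x k) - G k γ)) (-(G k γ - G k θs))
      rw [← h2, ← h1, norm_neg, norm_neg] at h3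
      linarith [hlip k]
    have hsum := Finset.sum_le_sum fun k (_ : k ∈ Finset.univ) => hterm k
    simp_rw [Finset.sum_add_distrib, ← Finset.mul_sum] at hsum
    linarith
  · have hterm : ∀ k, ‖G k (x k) - G k θs‖ ^ 2 ≤
        2 * L ^ 2 * ‖x k - γ‖ ^ 2 + 2 * ‖G k γ - G k θs‖ ^ 2 := by
      intro k
      have h3 := norm_add2_sq (G k (x k) - G k γ) (G k γ - G k θs)
      rw [sub_add_sub_cancel] at h3
      linarith [hlip k]
    have hsum := Finset.sum_le_sum fun k (_ : k ∈ Finset.univ) => hterm k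
    simp_rw [Finset.sum_add_distrib, ← Finset.mul_sum] at hsum
    linarith

/-- First-order optimality at the global minimizer. -/
lemma grad_zero {m : ℕ} {f : Fin m → E → ℝ} {G : Fin m → E → E}
    {L μ : ℝ} (hL : 0 < L) (hμ : 0 < μ) (hm : 1 ≤ m)
    (hsc : ∀ k x y, f k x + ⟪G k x, y - x⟫ + μ / 2 * ‖y - x‖ ^ 2 ≤ f k y)
    (hsm : ∀ k x y, ‖G k x - G k y‖ ≤ L * ‖x - y‖) (θs : E)
    (hmin : ∀ x, ∑ k, f k θs ≤ ∑ k, f k x) : ∑ k, G k θs = 0 := by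
  have hm' : (0 : ℝ) < m := by exact_mod_cast hm
  set v := ∑ k, G k θs with hv
  set s : ℝ := 1 / (2 * L * m) with hs
  have h1 : ∑ k, f k (θs - s • v) ≤
      ∑ k, (f k θs + ⟪G k θs, (θs - s • v) - θs⟫ + L * ‖(θs - s • v) - θs‖ ^ 2) :=
    Finset.sum_le_sum fun k _ => descent hμ (hsc k) (hsm k) θs _
  have e : (θs - s • v) - θs = - (s • v) := by abel
  rw [Finset.sum_add_distrib, Finset.sum_add_distrib, ← sum_inner, ← hv, e, inner_neg_right,
    inner_smul_right, real_inner_self_eq_norm_sq, norm_neg, norm_smul, mul_pow, Real.norm_eq_abs,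
    sq_abs] at h1
  simp only [Finset.sum_const, Finset.card_univ, Fintype.card_fin, nsmul_eq_mul] at h1
  have h2 := hmin (θs - s • v)
  have h3 : s * ‖v‖ ^ 2 - m * (L * (s ^ 2 * ‖v‖ ^ 2)) = s / 2 * ‖v‖ ^ 2 := by
    rw [hs]; field_simp; ring
  have h4 : s / 2 * ‖v‖ ^ 2 ≤ 0 := by linarith
  have h5 : 0 < s / 2 := by positivity
  have h6 : ‖v‖ ^ 2 ≤ 0 := by
    by_contra hcon
    push Not at hcon
    nlinarith [mul_pos h5 hcon]
  have h7 : ‖v‖ = 0 := by nlinarith [norm_nonneg v]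
  exact norm_eq_zero.1 h7

end FedDynAux

/-- FedDyn convergence rate, strongly convex case. -/
theorem feddyn_convergence_strongly_convex
    (d m P T : ℕ) (hd : 1 ≤ d) (hm : 1 ≤ m) (hP1 : 1 ≤ P) (hPm : P ≤ m) (hT : 1 ≤ T)
    (α L μ : ℝ) (hα : 0 < α) (hL : 0 < L) (hμ : 0 < μ)
    (hαc : max (5 * ((m : ℝ) / P) * μ) (30 * L) ≤ α)
    (Lk : Fin m → EuclideanSpace ℝ (Fin d) → ℝ)
    (hdiff : ∀ k, Differentiable ℝ (Lk k))
    (hsc : ∀ k x y, Lk k x + ⟪gradient (Lk k) x, y - x⟫ + μ / 2 * ‖y - x‖ ^ 2 ≤ Lk k y)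
    (hsmooth : ∀ k x y, ‖gradient (Lk k) x - gradient (Lk k) y‖ ≤ L * ‖x - y‖)
    (ℓ : EuclideanSpace ℝ (Fin d) → ℝ)
    (hℓ : ∀ x, ℓ x = (m : ℝ)⁻¹ * ∑ k, Lk k x)
    (θstar : EuclideanSpace ℝ (Fin d)) (hmin : ∀ x, ℓ θstar ≤ ℓ x)
    (θ0 : EuclideanSpace ℝ (Fin d))
    -- the FedDyn process, as functions of the random sequence of active sets
    (θ : (Fin T → {S : Finset (Fin m) // S.card = P}) → ℕ → EuclideanSpace ℝ (Fin d))
    (θdev : (Fin T → {S : Finset (Fin m) // S.card = P}) → ℕ → Fin m → EuclideanSpace ℝ (Fin d))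
    (g : (Fin T → {S : Finset (Fin m) // S.card = P}) → ℕ → Fin m → EuclideanSpace ℝ (Fin d))
    (h : (Fin T → {S : Finset (Fin m) // S.card = P}) → ℕ → EuclideanSpace ℝ (Fin d))
    (γ : (Fin T → {S : Finset (Fin m) // S.card = P}) → ℕ → EuclideanSpace ℝ (Fin d))
    (hθ0 : ∀ ω, θ ω 0 = θ0)
    (hg0 : ∀ ω k, g ω 0 k = 0)
    (hh0 : ∀ ω, h ω 0 = 0)
    -- active devices minimize the dynamically regularized local objective ...
    (hdevmin : ∀ ω (t : Fin T), ∀ k ∈ (ω t).1, ∀ x,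
      Lk k (θdev ω (t.1 + 1) k) - ⟪g ω t.1 k, θdev ω (t.1 + 1) k⟫
          + α / 2 * ‖θdev ω (t.1 + 1) k - θ ω t.1‖ ^ 2 ≤
        Lk k x - ⟪g ω t.1 k, x⟫ + α / 2 * ‖x - θ ω t.1‖ ^ 2)
    (hfoc : ∀ ω (t : Fin T), ∀ k ∈ (ω t).1,
      gradient (Lk k) (θdev ω (t.1 + 1) k) - g ω t.1 k
        + α • (θdev ω (t.1 + 1) k - θ ω t.1) = 0)
    (hgupd : ∀ ω (t : Fin T), ∀ k ∈ (ω t).1,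
      g ω (t.1 + 1) k = g ω t.1 k - α • (θdev ω (t.1 + 1) k - θ ω t.1))
    (hstaleθ : ∀ ω (t : Fin T), ∀ k ∉ (ω t).1, θdev ω (t.1 + 1) k = θdev ω t.1 k)
    (hstaleg : ∀ ω (t : Fin T), ∀ k ∉ (ω t).1, g ω (t.1 + 1) k = g ω t.1 k)
    (hhupd : ∀ ω (t : Fin T),
      h ω (t.1 + 1) = h ω t.1 - (α / m) • ∑ k ∈ (ω t).1, (θdev ω (t.1 + 1) k - θ ω t.1))
    (hθupd : ∀ ω (t : Fin T),
      θ ω (t.1 + 1) = (P : ℝ)⁻¹ • ∑ k ∈ (ω t).1, θdev ω (t.1 + 1) k - α⁻¹ • h ω (t.1 + 1))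
    (hγ0 : ∀ ω, γ ω 0 = θ0)
    (hγ : ∀ ω (t : Fin T),
      γ ω (t.1 + 1) = (P : ℝ)⁻¹ • ∑ k ∈ (ω t).1, θdev ω (t.1 + 1) k)
    (r R : ℝ) (hr : r = 1 + μ / α) (hR : R = ∑ t ∈ Finset.range T, r ^ t) :
    (∑ ω : (Fin T → {S : Finset (Fin m) // S.card = P}),
        (ℓ (R⁻¹ • ∑ t ∈ Finset.range T, r ^ t • γ ω t) - ℓ θstar)) /
      (Fintype.card (Fin T → {S : Finset (Fin m) // S.card = P}) : ℝ) ≤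
    (r ^ (T - 1))⁻¹ * (20 * α * ‖θ0 - θstar‖ ^ 2 +
      400 / α * ((m : ℝ) / P) * ((m : ℝ)⁻¹ * ∑ k, ‖gradient (Lk k) θstar‖ ^ 2)) := by
  classical
  have hm' : (0 : ℝ) < m := by exact_mod_cast hm
  have hP' : (0 : ℝ) < P := by exact_mod_cast hP1
  have hPm' : (P : ℝ) ≤ m := by exact_mod_cast hPm
  set G : Fin m → EuclideanSpace ℝ (Fin d) → EuclideanSpace ℝ (Fin d) :=
    fun k => gradient (Lk k) with hGdef
  obtain ⟨p, hpdef⟩ : ∃ p : ℝ, p = P / m := ⟨_, rfl⟩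
  have hp : 0 < p := by rw [hpdef]; positivity
  have hp1 : p ≤ 1 := by rw [hpdef, div_le_one hm']; exact hPm'
  have hLα : 30 * L ≤ α := (le_max_right _ _).trans hαc
  have hμp : 5 * μ ≤ p * α := by
    have h1 : 5 * ((m : ℝ) / P) * μ ≤ α := (le_max_left _ _).trans hαc
    have h2 := mul_le_mul_of_nonneg_left h1 hp.le
    have h3 : p * (5 * ((m : ℝ) / P) * μ) = 5 * μ := by rw [hpdef]; field_simp
    linarith
  have hr1 : 1 ≤ r := by
    rw [hr]; have : 0 < μ / α := by positivity
    linarith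
  have hr0 : 0 < r := by linarith
  obtain ⟨κ, hκ⟩ : ∃ κ : ℝ, κ = 41 / 10 / (p * α ^ 2) := ⟨_, rfl⟩
  have hκ0 : 0 < κ := by rw [hκ]; positivity
  have hminS : ∀ x, ∑ k, Lk k θstar ≤ ∑ k, Lk k x := by
    intro x
    have h1 := hmin x
    rw [hℓ, hℓ] at h1
    exact le_of_mul_le_mul_left h1 (by positivity)
  have hG0 : ∑ k, G k θstar = 0 :=
    FedDynAux.grad_zero hL hμ hm hsc hsmooth θstar hminS
  choose X hX1 hX2 using fun k g θ => FedDynAux.prox_exists hL hLα (hsmooth k) g θ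
  -- the Markov chain
  let State := EuclideanSpace ℝ (Fin d) × (Fin m → EuclideanSpace ℝ (Fin d))
  let th : State → EuclideanSpace ℝ (Fin d) :=
    fun s => s.1 - α⁻¹ • (m : ℝ)⁻¹ • ∑ j, s.2 j
  let x : State → Fin m → EuclideanSpace ℝ (Fin d) := fun s k => X k (s.2 k) (th s)
  let step : State → {S : Finset (Fin m) // S.card = P} → State :=
    fun s S => ((P : ℝ)⁻¹ • ∑ k ∈ S.1, x s k, fun k => if k ∈ S.1 then G k (x s k) else s.2 k)
  let V : State → ℝ := fun s => ‖s.1 - θstar‖ ^ 2 + κ / m * ∑ k, ‖s.2 k - G k θstar‖ ^ 2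
  let D : State → ℝ := fun s => (ℓ s.1 - ℓ θstar) / (5 * α)
  have hV : ∀ s, 0 ≤ V s := fun s => by simp only [V]; positivity
  have hstep : ∀ s, (Fintype.card {S : Finset (Fin m) // S.card = P} : ℝ) * D s +
      r * ∑ a, V (step s a) ≤ Fintype.card {S : Finset (Fin m) // S.card = P} * V s := by
    intro s
    set N : ℝ := (Fintype.card {S : Finset (Fin m) // S.card = P} : ℝ) with hN
    have hN0 : 0 ≤ N := by rw [hN]; positivity
    have h1 := FedDynAux.one_step hm hα hL hμ hp hμp hp1 hLα hr hκ hsc hsmooth θstar hminS hG0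
      s.1 s.2 (x s) (fun k => hX1 k _ _)
    set A := ∑ k, ‖x s k - θstar‖ ^ 2 with hA
    set C := ∑ k, ‖s.2 k - G k θstar‖ ^ 2 with hC
    set B := ∑ k, ‖G k (x s k) - G k θstar‖ ^ 2 with hB
    have hper : ∀ S : {S : Finset (Fin m) // S.card = P}, V (step s S) ≤
        κ / m * C + ∑ k ∈ S.1, ((P : ℝ)⁻¹ * ‖x s k - θstar‖ ^ 2 +
          κ / m * (‖G k (x s k) - G k θstar‖ ^ 2 - ‖s.2 k - G k θstar‖ ^ 2)) := by
      intro S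
      have hj := FedDynAux.jensen_sq S.1 P hP1 S.2 (x s) θstar
      have e1 : ∑ k, ‖(step s S).2 k - G k θstar‖ ^ 2 = C +
          ∑ k ∈ S.1, (‖G k (x s k) - G k θstar‖ ^ 2 - ‖s.2 k - G k θstar‖ ^ 2) := by
        have e2 : ∀ k, ‖(step s S).2 k - G k θstar‖ ^ 2 = ‖s.2 k - G k θstar‖ ^ 2 +
            if k ∈ S.1 then (‖G k (x s k) - G k θstar‖ ^ 2 - ‖s.2 k - G k θstar‖ ^ 2)
              else 0 := by
          intro k
          by_cases hk : k ∈ S.1 <;> simp [step, hk]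
        rw [Finset.sum_congr rfl fun k _ => e2 k, Finset.sum_add_distrib, Finset.sum_ite_mem,
          Finset.univ_inter]
      have e3 : V (step s S) = ‖(P : ℝ)⁻¹ • ∑ k ∈ S.1, x s k - θstar‖ ^ 2 +
          κ / m * ∑ k, ‖(step s S).2 k - G k θstar‖ ^ 2 := rfl
      rw [e3, e1, Finset.sum_add_distrib, ← Finset.mul_sum, ← Finset.mul_sum]
      linarith
    have hsum := Finset.sum_le_sum fun S
      (_ : S ∈ (Finset.univ : Finset {S : Finset (Fin m) // S.card = P})) => hper S
    rw [Finset.sum_add_distrib (f := fun _ => κ / m * C), Finset.sum_const, Finset.card_univ,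
      nsmul_eq_mul, ← hN] at hsum
    have hsub := FedDynAux.sum_subsets m P (fun k => (P : ℝ)⁻¹ * ‖x s k - θstar‖ ^ 2 +
          κ / m * (‖G k (x s k) - G k θstar‖ ^ 2 - ‖s.2 k - G k θstar‖ ^ 2))
    rw [Finset.sum_add_distrib, ← Finset.mul_sum, ← Finset.mul_sum, Finset.sum_sub_distrib,
      ← hN, ← hA, ← hB, ← hC] at hsub
    have hsum' : ∑ a, V (step s a) ≤ N / m * (A + κ * (C + p * (B - C))) := by
      refine hsum.trans (le_of_eq ?_)
      rw [← mul_right_inj' hm'.ne', mul_add, hsub, hpdef]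
      field_simp
      ring
    have hD : N * D s = N / m * ((∑ k, Lk k s.1 - ∑ k, Lk k θstar) / (5 * α)) := by
      simp only [D, hℓ]; field_simp
    have hVs : N * V s = N / m * (m * ‖s.1 - θstar‖ ^ 2 + κ * C) := by
      simp only [V, ← hC]; field_simp
    rw [hD, hVs]
    calc _ ≤ N / m * ((∑ k, Lk k s.1 - ∑ k, Lk k θstar) / (5 * α)) +
          r * (N / m * (A + κ * (C + p * (B - C)))) := by gcongr
      _ = N / m * ((∑ k, Lk k s.1 - ∑ k, Lk k θstar) / (5 * α) +
          r * (A + κ * (C + p * (B - C)))) := by ring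
      _ ≤ _ := by gcongr
  -- invariants
  have hinvh : ∀ ω (t : ℕ), t ≤ T → h ω t = (m : ℝ)⁻¹ • ∑ k, g ω t k := by
    intro ω t
    induction t with
    | zero => intro _; simp [hh0, hg0]
    | succ t ih =>
      intro ht
      have e1 : ∀ k, g ω (t + 1) k = g ω t k -
          if k ∈ (ω ⟨t, ht⟩).1 then α • (θdev ω (t + 1) k - θ ω t) else 0 := by
        intro k
        by_cases hk : k ∈ (ω ⟨t, ht⟩).1
        · rw [if_pos hk]; exact hgupd ω ⟨t, ht⟩ k hk
        · rw [if_neg hk, sub_zero]; exact hstaleg ω ⟨t, ht⟩ k hk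
      rw [Finset.sum_congr rfl fun k _ => e1 k, Finset.sum_sub_distrib, Finset.sum_ite_mem,
        Finset.univ_inter, smul_sub, ← ih (by omega), ← Finset.smul_sum, smul_smul]
      have := hhupd ω ⟨t, ht⟩
      simp only at this
      rw [this]
      congr 2
      field_simp
  have hinvθ : ∀ ω (t : ℕ), t ≤ T → θ ω t = th (γ ω t, g ω t) := by
    intro ω t ht
    simp only [th]
    rw [← hinvh ω t ht]
    cases t with
    | zero => simp [hh0, hγ0, hθ0]
    | succ t =>
      have h1 := hθupd ω ⟨t, ht⟩
      have h2 := hγ ω ⟨t, ht⟩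
      simp only at h1 h2
      rw [h1, h2]
  have hdev : ∀ ω (t : Fin T), ∀ k ∈ (ω t).1,
      θdev ω (t.1 + 1) k = x (γ ω t.1, g ω t.1) k := by
    intro ω t k hk
    refine hX2 k _ _ _ ?_
    rw [← hinvθ ω t.1 t.2.le]
    exact hfoc ω t k hk
  have htel := FedDynAux.telescope step V D r hr0.le hV hstep T (θ0, fun _ => 0)
    (fun ω t => (γ ω t, g ω t)) (fun ω => by
      refine Prod.ext (hγ0 ω) (funext fun k => hg0 ω k)) (fun ω t => by
      refine Prod.ext ?_ (funext fun k => ?_)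
      · simp only [step]
        rw [hγ ω t]
        congr 1
        exact Finset.sum_congr rfl fun k hk => hdev ω t k hk
      · simp only [step]
        by_cases hk : k ∈ (ω t).1
        · rw [if_pos hk, hgupd ω t k hk, ← hdev ω t k hk]
          have := hfoc ω t k hk
          rw [← sub_eq_zero, ← neg_eq_zero, ← this]
          simp only [hGdef]; abel
        · rw [if_neg hk, hstaleg ω t k hk])
  -- Jensen for the weighted average
  have hRge : r ^ (T - 1) ≤ R := by
    rw [hR]
    exact Finset.single_le_sum (f := fun t => r ^ t) (fun t _ => by positivity)
      (Finset.mem_range.2 (by omega))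
  have hRpos : 0 < R := lt_of_lt_of_le (by positivity) hRge
  have hjen : ∀ ω, ℓ (R⁻¹ • ∑ t ∈ Finset.range T, r ^ t • γ ω t) - ℓ θstar ≤
      R⁻¹ * (5 * α * ∑ t ∈ Finset.range T, r ^ t * D (γ ω t, g ω t)) := by
    intro ω
    set z := R⁻¹ • ∑ t ∈ Finset.range T, r ^ t • γ ω t with hz
    set v := (m : ℝ)⁻¹ • ∑ k, G k z with hv
    have hconv : ∀ y, ℓ z + ⟪v, y - z⟫ ≤ ℓ y := by
      intro y
      have h1 : ∑ k, (Lk k z + ⟪G k z, y - z⟫) ≤ ∑ k, Lk k y := by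
        refine Finset.sum_le_sum fun k _ => ?_
        have h2 := hsc k z y
        have h3 : 0 ≤ μ / 2 * ‖y - z‖ ^ 2 := by positivity
        simp only [hGdef]
        linarith
      rw [Finset.sum_add_distrib, ← sum_inner] at h1
      have h2 := mul_le_mul_of_nonneg_left h1 (by positivity : (0 : ℝ) ≤ (m : ℝ)⁻¹)
      rw [hv, real_inner_smul_left, hℓ, hℓ]
      linarith
    have h1 : ∑ t ∈ Finset.range T, r ^ t * (ℓ z + ⟪v, γ ω t - z⟫) ≤
        ∑ t ∈ Finset.range T, r ^ t * ℓ (γ ω t) :=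
      Finset.sum_le_sum fun t _ => mul_le_mul_of_nonneg_left (hconv _) (by positivity)
    have h2 : ∑ t ∈ Finset.range T, r ^ t * ⟪v, γ ω t - z⟫ = 0 := by
      have : ∀ t, r ^ t * ⟪v, γ ω t - z⟫ = ⟪v, r ^ t • γ ω t - r ^ t • z⟫ := by
        intro t; rw [← smul_sub, real_inner_smul_right]
      rw [Finset.sum_congr rfl fun t _ => this t, ← inner_sum, Finset.sum_sub_distrib,
        ← Finset.sum_smul, ← hR, hz, smul_smul, mul_inv_cancel₀ hRpos.ne', one_smul, sub_self,
        inner_zero_right]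
    simp_rw [mul_add, Finset.sum_add_distrib] at h1
    rw [h2, ← Finset.sum_mul, ← hR, add_zero] at h1
    have h3 : 5 * α * ∑ t ∈ Finset.range T, r ^ t * D (γ ω t, g ω t) =
        ∑ t ∈ Finset.range T, r ^ t * ℓ (γ ω t) - R * ℓ θstar := by
      rw [hR, Finset.sum_mul, ← Finset.sum_sub_distrib, Finset.mul_sum]
      refine Finset.sum_congr rfl fun t _ => ?_
      simp only [D]
      field_simp
    rw [h3, le_inv_mul_iff₀ hRpos]
    linarith
  have hsumω := Finset.sum_le_sum fun ω
    (_ : ω ∈ (Finset.univ : Finset (Fin T → {S : Finset (Fin m) // S.card = P}))) => hjen ω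
  rw [← Finset.mul_sum, ← Finset.mul_sum] at hsumω
  set Q := (m : ℝ)⁻¹ * ∑ k, ‖gradient (Lk k) θstar‖ ^ 2 with hQ
  have hQ0 : 0 ≤ Q := by rw [hQ]; positivity
  have hV0 : 5 * α * V (θ0, fun _ => 0) ≤
      20 * α * ‖θ0 - θstar‖ ^ 2 + 400 / α * ((m : ℝ) / P) * Q := by
    have e1 : V (θ0, fun _ => 0) = ‖θ0 - θstar‖ ^ 2 + κ * Q := by
      simp only [V, hQ, zero_sub, norm_neg, hGdef]
      ring
    have e2 : 5 * α * (κ * Q) = 41 / 2 * (1 / α * ((m : ℝ) / P) * Q) := by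
      rw [hκ, hpdef]; field_simp; ring
    have e3 : 400 / α * ((m : ℝ) / P) * Q = 400 * (1 / α * ((m : ℝ) / P) * Q) := by ring
    have h4 : 0 ≤ 1 / α * ((m : ℝ) / P) * Q := by positivity
    have h5 : 0 ≤ α * ‖θ0 - θstar‖ ^ 2 := by positivity
    rw [e1, mul_add, e2, e3]
    linarith
  have hfin0 : 0 ≤ 20 * α * ‖θ0 - θstar‖ ^ 2 + 400 / α * ((m : ℝ) / P) * Q := by positivity
  refine div_le_of_le_mul₀ (by positivity) (by positivity) ?_
  refine hsumω.trans ?_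
  rw [Fintype.card_fun, Fintype.card_fin, Nat.cast_pow]
  set NT := (Fintype.card {S : Finset (Fin m) // S.card = P} : ℝ) ^ T with hNT
  have hNT0 : 0 ≤ NT := by rw [hNT]; positivity
  calc _ ≤ R⁻¹ * (5 * α * (NT * V (θ0, fun _ => 0))) := by gcongr
    _ = R⁻¹ * ((5 * α * V (θ0, fun _ => 0)) * NT) := by ring
    _ ≤ (r ^ (T - 1))⁻¹ *
        ((20 * α * ‖θ0 - θstar‖ ^ 2 + 400 / α * ((m : ℝ) / P) * Q) * NT) := by
      gcongr
    _ = _ := by ring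
end

section
/- (One-round FedDyn descent, convex case.) Assume each L_k is convex and α ≥ 25·L, and set κ = 8·(m/P)·(1/α)·(L + α)/(α² − 20·L²) and κ₀ = (2/α)·(α² − 20·α·L − 40·L²)/(α² − 20·L²). Then E_𝒫[ ‖γ(𝒫) − θ*‖² ] + κ · E_𝒫[ C⁺(𝒫) ] ≤ ‖γ̄ − θ*‖² + κ·C − κ₀·( ℓ(γ̄) − ℓ(θ*) ). -/
open scoped RealInnerProductSpace

section helpers

variable {E : Type*} [NormedAddCommGroup E] [InnerProductSpace ℝ E] [CompleteSpace E]

lemma line_deriv {f : E → ℝ} (hf : Differentiable ℝ f) (x v : E) (t : ℝ) :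
    HasDerivAt (fun t : ℝ => f (x + t • v)) (⟪gradient f (x + t • v), v⟫) t := by
  have h1 : HasDerivAt (fun t : ℝ => x + t • v) v t := by
    simpa using ((hasDerivAt_id t).smul_const v).const_add x
  have h2 := (hf (x + t • v)).hasGradientAt.hasFDerivAt
  have h3 := h2.comp_hasDerivAt t h1
  rw [InnerProductSpace.toDual_apply_apply] at h3
  exact h3

lemma convex_first_order {f : E → ℝ} (hf : Differentiable ℝ f) (hc : ConvexOn ℝ Set.univ f)
    (x y : E) : f x + ⟪gradient f x, y - x⟫ ≤ f y := by
  have hc' : ConvexOn ℝ Set.univ (fun t : ℝ => f (x + t • (y - x))) := by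
    have := hc.comp_affineMap (AffineMap.lineMap x y : ℝ →ᵃ[ℝ] E)
    have e : (fun t : ℝ => f (x + t • (y - x))) = f ∘ (AffineMap.lineMap x y : ℝ →ᵃ[ℝ] E) := by
      funext t
      simp [AffineMap.lineMap_apply, add_comm]
    rw [e]
    exact this
  have h := hc'.le_slope_of_hasDerivAt (Set.mem_univ (0 : ℝ)) (Set.mem_univ (1 : ℝ)) one_pos
    (line_deriv hf x (y - x) 0)
  simp only [slope_def_field, zero_smul, add_zero, one_smul, add_sub_cancel, sub_zero,
    div_one] at h
  linarith

lemma smooth_upper {f : E → ℝ} {L : ℝ} (hf : Differentiable ℝ f)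
    (hs : ∀ x y, ‖gradient f x - gradient f y‖ ≤ L * ‖x - y‖)
    (x y : E) : f y ≤ f x + ⟪gradient f x, y - x⟫ + L / 2 * ‖y - x‖ ^ 2 := by
  set v := y - x with hv
  have hd : ∀ t : ℝ, HasDerivAt
      (fun t : ℝ => f (x + t • v) - t * ⟪gradient f x, v⟫ - L / 2 * ‖v‖ ^ 2 * t ^ 2)
      (⟪gradient f (x + t • v), v⟫ - ⟪gradient f x, v⟫ - L * ‖v‖ ^ 2 * t) t := by
    intro t
    have h1 := ((line_deriv hf x v t).sub
      ((hasDerivAt_id t).mul_const (⟪gradient f x, v⟫))).sub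
      ((hasDerivAt_pow 2 t).const_mul (L / 2 * ‖v‖ ^ 2))
    refine h1.congr_deriv ?_
    simp only [one_mul, Nat.cast_ofNat]
    ring
  have hanti : AntitoneOn
      (fun t : ℝ => f (x + t • v) - t * ⟪gradient f x, v⟫ - L / 2 * ‖v‖ ^ 2 * t ^ 2)
      (Set.Icc 0 1) := by
    apply antitoneOn_of_deriv_nonpos (convex_Icc 0 1)
    · exact fun t _ => (hd t).continuousAt.continuousWithinAt
    · exact fun t _ => (hd t).differentiableAt.differentiableWithinAt
    · intro t ht
      rw [interior_Icc] at ht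
      rw [(hd t).deriv, ← inner_sub_left]
      have h1 := real_inner_le_norm (gradient f (x + t • v) - gradient f x) v
      have h2 := hs (x + t • v) x
      rw [add_sub_cancel_left, norm_smul, Real.norm_eq_abs, abs_of_pos ht.1] at h2
      nlinarith [norm_nonneg v]
  have h := hanti (Set.left_mem_Icc.2 zero_le_one) (Set.right_mem_Icc.2 zero_le_one) zero_le_one
  have e : x + v = y := by rw [hv, add_sub_cancel]
  simp only [zero_smul, add_zero, one_smul, e, one_mul, zero_mul, sub_zero, one_pow, mul_one,
    ne_eq, OfNat.ofNat_ne_zero, not_false_eq_true, zero_pow, mul_zero] at h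
  linarith

lemma cocoercive {f : E → ℝ} {L : ℝ} (hL : 0 < L) (hf : Differentiable ℝ f)
    (hc : ConvexOn ℝ Set.univ f)
    (hs : ∀ x y, ‖gradient f x - gradient f y‖ ≤ L * ‖x - y‖) (x y : E) :
    ‖gradient f x - gradient f y‖ ^ 2 ≤ 2 * L * (f x - f y - ⟪gradient f y, x - y⟫) := by
  set w := gradient f x - gradient f y with hw
  have h1 := convex_first_order hf hc y (x - L⁻¹ • w)
  have h2 := smooth_upper hf hs x (x - L⁻¹ • w)
  have e1 : x - L⁻¹ • w - y = (x - y) - L⁻¹ • w := by abel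
  have e2 : x - L⁻¹ • w - x = -(L⁻¹ • w) := by abel
  rw [e1, inner_sub_right, inner_smul_right] at h1
  rw [e2, inner_neg_right, inner_smul_right, norm_neg, norm_smul, Real.norm_eq_abs,
    abs_of_pos (inv_pos.2 hL)] at h2
  have e3 : ⟪gradient f x, w⟫ - ⟪gradient f y, w⟫ = ‖w‖ ^ 2 := by
    rw [← inner_sub_left, ← hw, real_inner_self_eq_norm_sq]
  have e4 : L / 2 * (L⁻¹ * ‖w‖) ^ 2 = L⁻¹ * ‖w‖ ^ 2 / 2 := by field_simp
  have e5 : L⁻¹ * ⟪gradient f x, w⟫ - L⁻¹ * ⟪gradient f y, w⟫ = L⁻¹ * ‖w‖ ^ 2 := by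
    rw [← mul_sub, e3]
  have h3 : L⁻¹ * ‖w‖ ^ 2 / 2 ≤ f x - f y - ⟪gradient f y, x - y⟫ := by linarith
  have h4 := mul_le_mul_of_nonneg_left h3 (by positivity : 0 ≤ 2 * L)
  have e6 : 2 * L * (L⁻¹ * ‖w‖ ^ 2 / 2) = ‖w‖ ^ 2 := by field_simp
  linarith

lemma young (a b : E) {t : ℝ} (ht : 0 < t) :
    ‖a + b‖ ^ 2 ≤ (1 + t) * ‖a‖ ^ 2 + (1 + t⁻¹) * ‖b‖ ^ 2 := by
  have h := norm_add_le a b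
  have h1 : ‖a + b‖ ^ 2 ≤ (‖a‖ + ‖b‖) ^ 2 := by gcongr
  have h2 : 0 ≤ t⁻¹ * (t * ‖a‖ - ‖b‖) ^ 2 := by positivity
  have h3 : t⁻¹ * (t * ‖a‖ - ‖b‖) ^ 2 = t * ‖a‖ ^ 2 - 2 * ‖a‖ * ‖b‖ + t⁻¹ * ‖b‖ ^ 2 := by
    field_simp
    ring
  nlinarith

lemma jensen_sq {ι : Type*} (S : Finset ι) (P : ℕ) (hP : 1 ≤ P) (hS : S.card = P)
    (x : ι → E) (y : E) :
    ‖(P : ℝ)⁻¹ • ∑ k ∈ S, x k - y‖ ^ 2 ≤ (P : ℝ)⁻¹ * ∑ k ∈ S, ‖x k - y‖ ^ 2 := by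
  have hP' : (0 : ℝ) < P := by exact_mod_cast hP
  have e : (P : ℝ)⁻¹ • ∑ k ∈ S, x k - y = (P : ℝ)⁻¹ • ∑ k ∈ S, (x k - y) := by
    rw [Finset.sum_sub_distrib, Finset.sum_const, hS, smul_sub, ← Nat.cast_smul_eq_nsmul ℝ,
      smul_smul, inv_mul_cancel₀ hP'.ne', one_smul]
  rw [e, norm_smul, Real.norm_eq_abs, abs_of_pos (inv_pos.2 hP'), mul_pow]
  have h1 : ‖∑ k ∈ S, (x k - y)‖ ^ 2 ≤ (∑ k ∈ S, ‖x k - y‖) ^ 2 := by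
    gcongr
    exact norm_sum_le _ _
  have h2 := sq_sum_le_card_mul_sum_sq (s := S) (f := fun k => ‖x k - y‖)
  rw [hS] at h2
  calc ((P : ℝ)⁻¹) ^ 2 * ‖∑ k ∈ S, (x k - y)‖ ^ 2
      ≤ ((P : ℝ)⁻¹) ^ 2 * (P * ∑ k ∈ S, ‖x k - y‖ ^ 2) := by
        gcongr
        exact h1.trans h2
    _ = _ := by field_simp

lemma sum_powersetCard_mem (m P : ℕ) (hP1 : 1 ≤ P) (hPm : P ≤ m) (f : Fin m → ℝ) :
    ∑ S ∈ Finset.powersetCard P (Finset.univ : Finset (Fin m)), ∑ k ∈ S, f k =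
      ((Finset.powersetCard P (Finset.univ : Finset (Fin m))).card : ℝ) * (P / m) * ∑ k, f k := by
  obtain ⟨n, rfl⟩ : ∃ n, m = n + 1 := ⟨m - 1, by omega⟩
  obtain ⟨p, rfl⟩ : ∃ p, P = p + 1 := ⟨P - 1, by omega⟩
  have hcount : ∀ k : Fin (n + 1),
      ((Finset.powersetCard (p + 1) (Finset.univ : Finset (Fin (n + 1)))).filter
        (fun S => k ∈ S)).card = n.choose p := by
    intro k
    have h1 := Finset.card_filter_add_card_filter_not
      (s := Finset.powersetCard (p + 1) (Finset.univ : Finset (Fin (n + 1)))) (fun S => k ∈ S)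
    have h2 : (Finset.powersetCard (p + 1) (Finset.univ : Finset (Fin (n + 1)))).filter
        (fun S => ¬ k ∈ S) = Finset.powersetCard (p + 1) (Finset.univ.erase k) := by
      ext S
      simp only [Finset.mem_filter, Finset.mem_powersetCard, Finset.subset_univ, true_and,
        Finset.subset_erase]
      tauto
    rw [h2, Finset.card_powersetCard, Finset.card_powersetCard,
      Finset.card_erase_of_mem (Finset.mem_univ k), Finset.card_univ, Fintype.card_fin,
      Nat.add_sub_cancel, Nat.choose_succ_succ'] at h1
    omega
  have h1 : ∑ S ∈ Finset.powersetCard (p + 1) (Finset.univ : Finset (Fin (n + 1))),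
      ∑ k ∈ S, f k = ∑ k, (n.choose p : ℝ) * f k := by
    have : ∀ S : Finset (Fin (n + 1)), ∑ k ∈ S, f k = ∑ k, if k ∈ S then f k else 0 := by
      intro S
      simp
    simp_rw [this]
    rw [Finset.sum_comm]
    refine Finset.sum_congr rfl fun k _ => ?_
    rw [← Finset.sum_filter, Finset.sum_const, hcount, nsmul_eq_mul]
  rw [h1, ← Finset.mul_sum, Finset.card_powersetCard, Finset.card_univ, Fintype.card_fin]
  congr 1
  have h2 := Nat.add_one_mul_choose_eq n p
  have h3 : ((n : ℝ) + 1) * n.choose p = (n + 1).choose (p + 1) * ((p : ℝ) + 1) := by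
    exact_mod_cast h2
  push_cast
  field_simp
  linarith

lemma sum_grad_zero {m : ℕ} {f : Fin m → E → ℝ} (hf : ∀ k, Differentiable ℝ (f k)) (x : E)
    (hmin : ∀ y, ∑ k, f k x ≤ ∑ k, f k y) : ∑ k, gradient (f k) x = 0 := by
  set G := ∑ k, gradient (f k) x with hG
  have h1 : HasDerivAt (fun t : ℝ => ∑ k, f k (x + t • G))
      (∑ k, ⟪gradient (f k) (x + (0 : ℝ) • G), G⟫) 0 :=
    HasDerivAt.fun_sum fun k _ => line_deriv (hf k) x G 0
  have h2 : IsLocalMin (fun t : ℝ => ∑ k, f k (x + t • G)) 0 := by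
    refine Filter.Eventually.of_forall fun t => ?_
    simpa using hmin (x + t • G)
  have h3 := h2.hasDerivAt_eq_zero h1
  simp only [zero_smul, add_zero] at h3
  rw [← sum_inner, ← hG] at h3
  exact inner_self_eq_zero.1 h3

end helpers

set_option maxHeartbeats 2000000 in
/-- one-round FedDyn descent, convex case. -/
theorem one_round_descent_convex
    (d m P : ℕ) (hd : 1 ≤ d) (hm : 1 ≤ m) (hP1 : 1 ≤ P) (hPm : P ≤ m)
    (α L : ℝ) (hα : 0 < α) (hL : 0 < L) (hαL : 25 * L ≤ α)
    (Lk : Fin m → EuclideanSpace ℝ (Fin d) → ℝ)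
    (hdiff : ∀ k, Differentiable ℝ (Lk k))
    (hconv : ∀ k, ConvexOn ℝ Set.univ (Lk k))
    (hsmooth : ∀ k x y, ‖gradient (Lk k) x - gradient (Lk k) y‖ ≤ L * ‖x - y‖)
    (ℓ : EuclideanSpace ℝ (Fin d) → ℝ)
    (hℓ : ∀ θ, ℓ θ = (m : ℝ)⁻¹ * ∑ k, Lk k θ)
    (θstar : EuclideanSpace ℝ (Fin d)) (hmin : ∀ θ, ℓ θstar ≤ ℓ θ)
    (θbar : EuclideanSpace ℝ (Fin d))
    (g : Fin m → EuclideanSpace ℝ (Fin d))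
    (h : EuclideanSpace ℝ (Fin d)) (hh : h = (m : ℝ)⁻¹ • ∑ k, g k)
    (γbar : EuclideanSpace ℝ (Fin d)) (hγbar : γbar = θbar + α⁻¹ • h)
    (θt : Fin m → EuclideanSpace ℝ (Fin d))
    (hfoc : ∀ k, gradient (Lk k) (θt k) - g k + α • (θt k - θbar) = 0)
    (κ κ₀ : ℝ)
    (hκ : κ = 8 * ((m : ℝ) / P) * α⁻¹ * (L + α) / (α ^ 2 - 20 * L ^ 2))
    (hκ₀ : κ₀ = 2 / α * ((α ^ 2 - 20 * α * L - 40 * L ^ 2) / (α ^ 2 - 20 * L ^ 2))) :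
    (∑ S ∈ Finset.powersetCard P (Finset.univ : Finset (Fin m)),
        ‖(P : ℝ)⁻¹ • ∑ k ∈ S, θt k - θstar‖ ^ 2) /
      ((Finset.powersetCard P (Finset.univ : Finset (Fin m))).card : ℝ) +
    κ * ((∑ S ∈ Finset.powersetCard P (Finset.univ : Finset (Fin m)),
        (m : ℝ)⁻¹ * (∑ k ∈ S, ‖gradient (Lk k) (θt k) - gradient (Lk k) θstar‖ ^ 2 +
          ∑ k ∈ Sᶜ, ‖g k - gradient (Lk k) θstar‖ ^ 2)) /
      ((Finset.powersetCard P (Finset.univ : Finset (Fin m))).card : ℝ)) ≤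
    ‖γbar - θstar‖ ^ 2 +
      κ * ((m : ℝ)⁻¹ * ∑ k, ‖g k - gradient (Lk k) θstar‖ ^ 2) -
      κ₀ * (ℓ γbar - ℓ θstar) := by
  have hm0 : (0 : ℝ) < m := by exact_mod_cast hm
  have hP0 : (0 : ℝ) < P := by exact_mod_cast hP1
  set N : ℝ := ((Finset.powersetCard P (Finset.univ : Finset (Fin m))).card : ℝ) with hN
  have hN0 : 0 < N := by
    rw [hN, Finset.card_powersetCard, Finset.card_univ, Fintype.card_fin]
    exact_mod_cast Nat.choose_pos hPm
  set s : Fin m → EuclideanSpace ℝ (Fin d) := fun k => gradient (Lk k) θstar with hs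
  set n : Fin m → EuclideanSpace ℝ (Fin d) := fun k => gradient (Lk k) (θt k) with hn
  set e : Fin m → EuclideanSpace ℝ (Fin d) := fun k => θt k - γbar with he
  set a := γbar - θstar with ha
  -- first term
  have T1 : (∑ S ∈ Finset.powersetCard P (Finset.univ : Finset (Fin m)),
        ‖(P : ℝ)⁻¹ • ∑ k ∈ S, θt k - θstar‖ ^ 2) / N ≤
        (m : ℝ)⁻¹ * ∑ k, ‖θt k - θstar‖ ^ 2 := by
    rw [div_le_iff₀ hN0]
    calc _ ≤ ∑ S ∈ Finset.powersetCard P (Finset.univ : Finset (Fin m)),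
          (P : ℝ)⁻¹ * ∑ k ∈ S, ‖θt k - θstar‖ ^ 2 :=
          Finset.sum_le_sum fun S hS => jensen_sq S P hP1 (Finset.mem_powersetCard.1 hS).2 _ _
      _ = _ := by
          rw [← Finset.mul_sum, sum_powersetCard_mem m P hP1 hPm, ← hN]
          field_simp
  -- second term
  have T2 : (∑ S ∈ Finset.powersetCard P (Finset.univ : Finset (Fin m)),
        (m : ℝ)⁻¹ * (∑ k ∈ S, ‖n k - s k‖ ^ 2 + ∑ k ∈ Sᶜ, ‖g k - s k‖ ^ 2)) / N =
        (m : ℝ)⁻¹ * ∑ k, ‖g k - s k‖ ^ 2 +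
        (P / m) * (m : ℝ)⁻¹ * (∑ k, ‖n k - s k‖ ^ 2 - ∑ k, ‖g k - s k‖ ^ 2) := by
    have : ∀ S : Finset (Fin m), ∑ k ∈ S, ‖n k - s k‖ ^ 2 + ∑ k ∈ Sᶜ, ‖g k - s k‖ ^ 2 =
        ∑ k, ‖g k - s k‖ ^ 2 + ∑ k ∈ S, (‖n k - s k‖ ^ 2 - ‖g k - s k‖ ^ 2) := by
      intro S
      rw [← Finset.sum_add_sum_compl S (fun k => ‖g k - s k‖ ^ 2), Finset.sum_sub_distrib]
      ring
    simp_rw [this]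
    rw [← Finset.mul_sum, Finset.sum_add_distrib, sum_powersetCard_mem m P hP1 hPm, ← hN,
      Finset.sum_const, nsmul_eq_mul, ← hN, Finset.sum_sub_distrib]
    field_simp
  have hs0 : ∑ k, s k = 0 := by
    apply sum_grad_zero hdiff
    intro y
    have := hmin y
    rw [hℓ, hℓ] at this
    exact le_of_mul_le_mul_left this (inv_pos.2 hm0)
  have hsumg : ∑ k, g k = (m : ℝ) • h := by
    rw [hh, smul_smul, mul_inv_cancel₀ hm0.ne', one_smul]
  have hek : ∀ k, α • e k = g k - n k - h := by
    intro k
    have h1 := hfoc k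
    have h2 : α • (α⁻¹ • h) = h := by rw [smul_smul, mul_inv_cancel₀ hα.ne', one_smul]
    simp only [he, hn, hγbar]
    rw [← sub_sub, smul_sub, h2]
    have h3 : α • (θt k - θbar) = g k - gradient (Lk k) (θt k) := by
      rw [← sub_eq_zero, ← h1]
      abel
    rw [h3]
  have hesum : α • ∑ k, e k = - ∑ k, n k := by
    rw [Finset.smul_sum]
    simp_rw [hek]
    rw [Finset.sum_sub_distrib, Finset.sum_sub_distrib, hsumg, Finset.sum_const,
      Finset.card_univ, Fintype.card_fin, ← Nat.cast_smul_eq_nsmul ℝ]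
    abel
  have hinner : α * ∑ k, ⟪a, e k⟫ = - ∑ k, ⟪a, n k⟫ := by
    rw [← inner_sum, ← inner_sum, ← inner_smul_right, hesum, inner_neg_right]
  -- D
  set D : ℝ := ∑ k, Lk k γbar - ∑ k, Lk k θstar with hD
  have hDl : ℓ γbar - ℓ θstar = (m : ℝ)⁻¹ * D := by
    rw [hℓ, hℓ, hD]
    ring
  set ε : ℝ := ∑ k, ‖e k‖ ^ 2 with hε
  set Ns : ℝ := ∑ k, ‖n k - s k‖ ^ 2 with hNs
  set C : ℝ := ∑ k, ‖g k - s k‖ ^ 2 with hC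
  have F1 : ∑ k, ‖θt k - θstar‖ ^ 2 = m * ‖a‖ ^ 2 + 2 * ∑ k, ⟪a, e k⟫ + ε := by
    have : ∀ k, ‖θt k - θstar‖ ^ 2 = ‖a‖ ^ 2 + 2 * ⟪a, e k⟫ + ‖e k‖ ^ 2 := by
      intro k
      rw [← norm_add_sq_real]
      congr 2
      simp only [ha, he]
      abel
    simp_rw [this]
    rw [Finset.sum_add_distrib, Finset.sum_add_distrib, Finset.sum_const, ← Finset.mul_sum,
      Finset.card_univ, Fintype.card_fin, nsmul_eq_mul]
  have F2 : D - L / 2 * ε ≤ ∑ k, ⟪a, n k⟫ := by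
    rw [hD, hε, ← Finset.sum_sub_distrib, Finset.mul_sum, ← Finset.sum_sub_distrib]
    refine Finset.sum_le_sum fun k _ => ?_
    have h1 := smooth_upper (hdiff k) (hsmooth k) (θt k) γbar
    have h2 := convex_first_order (hdiff k) (hconv k) (θt k) θstar
    have h3 : ⟪a, n k⟫ = ⟪n k, γbar - θt k⟫ - ⟪n k, θstar - θt k⟫ := by
      rw [← inner_sub_right, real_inner_comm]
      congr 1
      simp only [ha]
      abel
    have h4 : ‖e k‖ = ‖γbar - θt k‖ := norm_sub_rev _ _
    rw [h3, h4]
    simp only [hn]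
    linarith
  have F3 : α ^ 2 * ε ≤ 4 * C + 4 / 3 * Ns := by
    have hvar : ∑ k, ‖g k - s k - h‖ ^ 2 ≤ C := by
      have h1 : ∀ k, ‖g k - s k - h‖ ^ 2 = ‖g k - s k‖ ^ 2 - 2 * ⟪h, g k - s k⟫ + ‖h‖ ^ 2 := by
        intro k
        rw [norm_sub_sq_real, real_inner_comm]
      simp_rw [h1]
      rw [Finset.sum_add_distrib, Finset.sum_sub_distrib, ← Finset.mul_sum, ← inner_sum,
        Finset.sum_sub_distrib, hsumg, hs0, sub_zero, inner_smul_right,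
        real_inner_self_eq_norm_sq, Finset.sum_const, Finset.card_univ, Fintype.card_fin,
        nsmul_eq_mul]
      nlinarith [mul_nonneg hm0.le (sq_nonneg ‖h‖)]
    have h2 : α ^ 2 * ε ≤ ∑ k, (4 * ‖g k - s k - h‖ ^ 2 + 4 / 3 * ‖n k - s k‖ ^ 2) := by
      rw [hε, Finset.mul_sum]
      refine Finset.sum_le_sum fun k _ => ?_
      have h3 := young (g k - s k - h) (s k - n k) (t := 3) (by norm_num)
      have h4 : g k - s k - h + (s k - n k) = α • e k := by
        rw [hek]
        abel
      rw [h4, norm_smul, mul_pow, Real.norm_eq_abs, sq_abs, norm_sub_rev (s k)] at h3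
      norm_num at h3
      exact h3
    rw [Finset.sum_add_distrib, ← Finset.mul_sum, ← Finset.mul_sum] at h2
    linarith
  have F4 : Ns ≤ 15 / 7 * L ^ 2 * ε + 15 / 4 * L * D := by
    have h0 : ∑ k, ⟪s k, a⟫ = 0 := by rw [← sum_inner, hs0, inner_zero_left]
    have h1 : Ns ≤ ∑ k, (15 / 7 * L ^ 2 * ‖e k‖ ^ 2 +
        15 / 4 * L * (Lk k γbar - Lk k θstar - ⟪s k, a⟫)) := by
      refine Finset.sum_le_sum fun k _ => ?_
      have h2 := young (n k - gradient (Lk k) γbar) (gradient (Lk k) γbar - s k) (t := 8 / 7)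
        (by norm_num)
      rw [sub_add_sub_cancel] at h2
      have h3 := cocoercive hL (hdiff k) (hconv k) (hsmooth k) γbar θstar
      have h4 : ‖n k - gradient (Lk k) γbar‖ ^ 2 ≤ (L * ‖e k‖) ^ 2 := by
        gcongr
        exact hsmooth k _ _
      norm_num at h2
      simp only [hs, ha] at h2 ⊢
      nlinarith
    rw [Finset.sum_add_distrib, ← Finset.mul_sum, ← Finset.mul_sum, Finset.sum_sub_distrib,
      Finset.sum_sub_distrib, h0, sub_zero] at h1
    exact h1
  have hε0 : 0 ≤ ε := Finset.sum_nonneg fun k _ => by positivity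
  have hden : 0 < α ^ 2 - 20 * L ^ 2 := by nlinarith
  have key : (α ^ 2 - 20 * L ^ 2) / 8 * ε + Ns - C ≤ 5 * L * D := by
    have : 0 ≤ L ^ 2 * ε := by positivity
    have : 0 ≤ α ^ 2 * ε := by positivity
    have h5 : 625 * (L ^ 2 * ε) ≤ α ^ 2 * ε := by
      rw [← mul_assoc]
      gcongr
      nlinarith
    linarith
  set q : ℝ := 8 * α⁻¹ * (L + α) / (α ^ 2 - 20 * L ^ 2) with hq
  have hq0 : 0 ≤ q := by positivity
  have hκq : κ * (P / m) = q := by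
    rw [hκ, hq]
    field_simp
  have hκ₀q : κ₀ = 2 / α - 5 * L * q := by
    rw [hκ₀, hq]
    field_simp
    ring
  have key2 := mul_le_mul_of_nonneg_left key hq0
  have hq8 : q * ((α ^ 2 - 20 * L ^ 2) / 8 * ε + Ns - C) =
      (1 + L / α) * ε + q * (Ns - C) := by
    have : q * ((α ^ 2 - 20 * L ^ 2) / 8) = 1 + L / α := by
      have hne := hden.ne'
      rw [hq]
      generalize α ^ 2 - 20 * L ^ 2 = w at hne ⊢
      field_simp
      ring
    rw [← this]
    ring
  have F5 : 2 * ∑ k, ⟪a, e k⟫ ≤ -(2 / α) * D + L / α * ε := by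
    have h1 : ∑ k, ⟪a, e k⟫ ≤ α⁻¹ * (-(D - L / 2 * ε)) := by
      rw [← div_eq_inv_mul, le_div_iff₀ hα]
      linarith
    have h2 : 2 * (α⁻¹ * (-(D - L / 2 * ε))) = -(2 / α) * D + L / α * ε := by
      field_simp
      ring
    linarith
  have final : ∑ k, ‖θt k - θstar‖ ^ 2 + q * (Ns - C) ≤ m * ‖a‖ ^ 2 - κ₀ * D := by
    rw [F1, hκ₀q]
    linarith
  have final2 := mul_le_mul_of_nonneg_left final (inv_pos.2 hm0).le
  have e1 : (m : ℝ)⁻¹ * (m * ‖a‖ ^ 2 - κ₀ * D) = ‖a‖ ^ 2 - κ₀ * ((m : ℝ)⁻¹ * D) := by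
    field_simp
  have e2 : κ * ((m : ℝ)⁻¹ * C + P / m * (m : ℝ)⁻¹ * (Ns - C)) =
      κ * ((m : ℝ)⁻¹ * C) + (m : ℝ)⁻¹ * (q * (Ns - C)) := by
    rw [← hκq]
    ring
  rw [hDl]
  rw [e1, mul_add] at final2
  rw [T2, e2]
  linarith
end
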